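/- Let g = sl₂(ℂ) act diagonally on W = V ⊕ V ⊕ V, V the adjoint representation. Then O(J_∞(W))^{g[t]} is generated as a differential algebra by O(W)^{SL₂}; that is, it is generated as a ℂ-algebra by D^k(q_{ij}) for 1 ≤ i ≤ j ≤ 3 and D^k(c_{123}) for k ≥ 0. -/

import Mathlib

open MvPolynomial

/-- Structure constants of `sl₂` in the basis `0 = h`, `1 = x`, `2 = y`
(`[x,y] = h`, `[h,x] = 2x`, `[h,y] = -2y`): `slBr ξ η θ` is the coefficient of the
basis vector `θ` in `[ξ, η]`. -/
noncomputable def slBr : Fin 3 → Fin 3 → Fin 3 → ℂ :=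
  ![![![0,0,0], ![0,2,0], ![0,0,-2]],
    ![![0,-2,0], ![0,0,0], ![1,0,0]],
    ![![0,0,2], ![-1,0,0], ![0,0,0]]]

/-- The jet action of `ξ t^r ∈ sl₂[t]` on the arc space ring
`O(J_∞(V^{⊕m})) = ℂ[(a^η_i)^{(k)}]` of `m` copies of the adjoint representation:
on generators, `(ξ t^r)(u^{(k)}) = (k!/(k−r)!)(ξ·u)^{(k−r)}`, where
`ξ · a^η_i = a^{[ξ,η]}_i`. -/
noncomputable def arcDer (m : ℕ) (ξ : Fin 3) (r : ℕ) :
    Derivation ℂ (MvPolynomial ((Fin m × Fin 3) × ℕ) ℂ)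
      (MvPolynomial ((Fin m × Fin 3) × ℕ) ℂ) :=
  MvPolynomial.mkDerivation ℂ fun v =>
    (v.2.descFactorial r : ℂ) •
      ∑ θ : Fin 3, C (slBr ξ v.1.2 θ) * X ((v.1.1, θ), v.2 - r)

/-- The jet derivation `D`, with `D(u^{(k)}) = u^{(k+1)}`. -/
noncomputable def arcD (m : ℕ) :
    Derivation ℂ (MvPolynomial ((Fin m × Fin 3) × ℕ) ℂ)
      (MvPolynomial ((Fin m × Fin 3) × ℕ) ℂ) :=
  MvPolynomial.mkDerivation ℂ fun v => X (v.1, v.2 + 1)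

/-- The weight-zero quadratic `q_{ij} = a^h_i a^h_j + 2 a^x_i a^y_j + 2 a^x_j a^y_i`
in the arc space ring. -/
noncomputable def arcQ (m : ℕ) (i j : Fin m) :
    MvPolynomial ((Fin m × Fin 3) × ℕ) ℂ :=
  X ((i, 0), 0) * X ((j, 0), 0) + 2 * X ((i, 1), 0) * X ((j, 2), 0)
    + 2 * X ((j, 1), 0) * X ((i, 2), 0)

/-- The weight-zero cubic `c_{123}`: the determinant of the matrix with rows
`(a^h_i, a^x_i, a^y_i)`, `i = 1,2,3`, in the arc space ring of `V ⊕ V ⊕ V`. -/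
noncomputable def arcC : MvPolynomial ((Fin 3 × Fin 3) × ℕ) ℂ :=
  Matrix.det (Matrix.of fun i ξ : Fin 3 => X ((i, ξ), 0))

/-- `g` equals a unit multiple of the monomial `X ^ e` up to terms of strictly smaller key. -/
def HasLead {k σ Γ : Type*} [CommRing k] [LT Γ] (key : (σ →₀ ℕ) → Γ)
    (g : MvPolynomial σ k) (e : σ →₀ ℕ) : Prop :=
  IsUnit (coeff e g) ∧ ∀ a ∈ g.support, a = e ∨ key a < key e

section Lead

variable {k σ Γ : Type*} [CommRing k] [LinearOrder Γ] {key : (σ →₀ ℕ) → Γ}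

theorem HasLead.monomial (e : σ →₀ ℕ) : HasLead key (monomial e (1 : k)) e := by
  classical
  refine ⟨by simp, fun a ha => Or.inl ?_⟩
  exact (Finset.mem_singleton.1 (support_monomial_subset ha))

theorem HasLead.mul (hkey : ∀ a b c, key a < key b → key (a + c) < key (b + c))
    {g g' : MvPolynomial σ k} {e e' : σ →₀ ℕ}
    (h : HasLead key g e) (h' : HasLead key g' e') : HasLead key (g * g') (e + e') := by
  classical
  have aux : ∀ a ∈ g.support, ∀ b ∈ g'.support,
      (a = e ∧ b = e') ∨ key (a + b) < key (e + e') := by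
    intro a ha b hb
    rcases h.2 a ha with rfl | ha'
    · rcases h'.2 b hb with rfl | hb'
      · exact Or.inl ⟨rfl, rfl⟩
      · right
        simpa [add_comm] using hkey _ _ a hb'
    · right
      rcases h'.2 b hb with rfl | hb'
      · exact hkey _ _ _ ha'
      · refine (hkey _ _ b ha').trans ?_
        simpa [add_comm] using hkey _ _ e hb'
  constructor
  · rw [coeff_mul, Finset.sum_eq_single (e, e')]
    · exact h.1.mul h'.1
    · rintro ⟨a, b⟩ hab hne
      by_contra hc
      have ha : a ∈ g.support := mem_support_iff.2 (left_ne_zero_of_mul hc)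
      have hb : b ∈ g'.support := mem_support_iff.2 (right_ne_zero_of_mul hc)
      have hab : a + b = e + e' := by simpa using hab
      rcases aux a ha b hb with ⟨rfl, rfl⟩ | hlt
      · exact hne rfl
      · exact absurd (hab ▸ hlt) (lt_irrefl _)
    · intro hc
      simp at hc
  · intro a ha
    obtain ⟨b, hb, c, hc, rfl⟩ := Finset.mem_add.1 (support_mul _ _ ha)
    rcases aux b hb c hc with ⟨rfl, rfl⟩ | hlt
    · exact Or.inl rfl
    · exact Or.inr hlt

theorem HasLead.pow (hkey : ∀ a b c, key a < key b → key (a + c) < key (b + c))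
    {g : MvPolynomial σ k} {e : σ →₀ ℕ} (h : HasLead key g e) (n : ℕ) :
    HasLead key (g ^ n) (n • e) := by
  induction n with
  | zero => simpa using HasLead.monomial (k := k) (key := key) (0 : σ →₀ ℕ)
  | succ n ih => simpa [pow_succ, succ_nsmul] using ih.mul hkey h

theorem HasLead.prod {ι : Type*} (hkey : ∀ a b c, key a < key b → key (a + c) < key (b + c))
    (s : Finset ι) {g : ι → MvPolynomial σ k} {e : ι → σ →₀ ℕ}
    (h : ∀ i, HasLead key (g i) (e i)) : HasLead key (∏ i ∈ s, g i) (∑ i ∈ s, e i) := by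
  classical
  induction s using Finset.induction_on with
  | empty => simpa using HasLead.monomial (k := k) (key := key) (0 : σ →₀ ℕ)
  | insert i s hi ih => simpa [hi] using (h i).mul hkey ih

/-- The multiplicity of the monomial `m` in the monomial `e`. -/
noncomputable def monMult (m e : σ →₀ ℕ) : ℕ := sInf ((fun s => e s / m s) '' (m.support : Set σ))

theorem monMult_mul_le (m e : σ →₀ ℕ) {s : σ} (hs : m s ≠ 0) : monMult m e * m s ≤ e s := by
  have h : monMult m e ≤ e s / m s :=
    Nat.sInf_le (Set.mem_image_of_mem _ (by simpa using hs))
  exact (Nat.mul_le_mul_right _ h).trans (Nat.div_mul_le_self _ _)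

theorem monMult_add_self {m : σ →₀ ℕ} (hm : m ≠ 0) (e : σ →₀ ℕ) :
    monMult m (e + m) = monMult m e + 1 := by
  have hne : (m.support : Set σ).Nonempty := by simpa using hm
  have h1 : ∀ s ∈ m.support, (e + m) s / m s = e s / m s + 1 := fun s hs => by
    rw [Finsupp.add_apply, Nat.add_div_right _ (Nat.pos_of_ne_zero (by simpa using hs))]
  apply le_antisymm
  · obtain ⟨s, hs, he⟩ := Nat.sInf_mem (hne.image fun s => e s / m s)
    exact Nat.sInf_le ⟨s, hs, by rw [monMult, ← he]; exact h1 s hs⟩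
  · refine le_csInf (hne.image _) ?_
    rintro _ ⟨s, hs, rfl⟩
    change _ ≤ (e + m) s / m s
    rw [h1 s hs]
    exact Nat.add_le_add_right (Nat.sInf_le (Set.mem_image_of_mem _ hs)) 1

theorem monMult_add_of_disjoint {m m' : σ →₀ ℕ} (h : Disjoint m.support m'.support)
    (e : σ →₀ ℕ) : monMult m (e + m') = monMult m e := by
  unfold monMult
  congr 1
  refine Set.image_congr fun s hs => ?_
  have : m' s = 0 := by simpa using Finset.disjoint_left.1 h hs
  simp [this]

variable {ι : Type*} [Fintype ι]

theorem sum_monMult_le {m : ι → σ →₀ ℕ}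
    (hd : Pairwise fun i j => Disjoint (m i).support (m j).support) (e : σ →₀ ℕ) :
    ∑ i, monMult (m i) e • m i ≤ e := by
  classical
  intro s
  rw [Finsupp.finsetSum_apply]
  by_cases h : ∃ i, m i s ≠ 0
  · obtain ⟨i, hi⟩ := h
    rw [Finset.sum_eq_single i]
    · simpa using monMult_mul_le (m i) e hi
    · intro j _ hj
      have : m j s = 0 := by
        simpa using Finset.disjoint_left.1 (hd hj.symm) (by simpa using hi)
      simp [this]
    · simp
  · push Not at h
    simp [h]

/-- The product of a standard monomial and powers of the `F i` attached to the exponent `e`. -/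
noncomputable def stdElt (F : ι → MvPolynomial σ k) (m : ι → σ →₀ ℕ) (e : σ →₀ ℕ) :
    MvPolynomial σ k :=
  monomial (e - ∑ i, monMult (m i) e • m i) 1 * ∏ i, F i ^ monMult (m i) e

/-- The linear endomorphism sending each monomial to the corresponding standard element. -/
noncomputable def stdMap (F : ι → MvPolynomial σ k) (m : ι → σ →₀ ℕ) :
    MvPolynomial σ k →ₗ[k] MvPolynomial σ k :=
  (basisMonomials σ k).constr k (stdElt F m)

theorem stdMap_monomial (F : ι → MvPolynomial σ k) (m : ι → σ →₀ ℕ) (e : σ →₀ ℕ) :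
    stdMap F m (monomial e 1) = stdElt F m e := by
  exact (basisMonomials σ k).constr_basis k (stdElt F m) e

theorem stdMap_mul {F : ι → MvPolynomial σ k} {m : ι → σ →₀ ℕ} (hm : ∀ i, m i ≠ 0)
    (hd : Pairwise fun i j => Disjoint (m i).support (m j).support) (j : ι)
    (g : MvPolynomial σ k) : stdMap F m (monomial (m j) 1 * g) = F j * stdMap F m g := by
  classical
  have hα : ∀ e i, monMult (m i) (e + m j) = monMult (m i) e + if i = j then 1 else 0 := by
    intro e i
    split_ifs with h
    · subst h; exact monMult_add_self (hm i) e
    · exact monMult_add_of_disjoint (hd h) e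
  have hb : ∀ e, stdElt F m (m j + e) = F j * stdElt F m e := by
    intro e
    rw [add_comm]
    have h1 : e + m j - ∑ i, monMult (m i) (e + m j) • m i
        = e - ∑ i, monMult (m i) e • m i := by
      simp [hα, add_smul, Finset.sum_add_distrib, add_tsub_add_eq_tsub_right]
    have h2 : ∏ i, F i ^ monMult (m i) (e + m j) = (∏ i, F i ^ monMult (m i) e) * F j := by
      have h3 : ∏ i, F i ^ (if i = j then 1 else 0) = F j := by
        rw [Finset.prod_eq_single j (fun b _ hb => by simp [hb]) (by simp)]
        simp
      simp only [hα, pow_add, Finset.prod_mul_distrib, h3]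
    rw [stdElt, h1, h2, stdElt]
    ring
  have : (stdMap F m) ∘ₗ LinearMap.mulLeft k (monomial (m j) 1)
      = LinearMap.mulLeft k (F j) ∘ₗ stdMap F m := by
    refine (basisMonomials σ k).ext fun e => ?_
    simp [stdMap_monomial, hb, monomial_mul]
  exact LinearMap.congr_fun this g

variable {F : ι → MvPolynomial σ k} {m : ι → σ →₀ ℕ}

theorem stdElt_hasLead
    (hkey : ∀ a b c, key a < key b → key (a + c) < key (b + c))
    (hF : ∀ i, HasLead key (F i) (m i))
    (hd : Pairwise fun i j => Disjoint (m i).support (m j).support) (e : σ →₀ ℕ) :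
    HasLead key (stdElt F m e) e := by
  have h := (HasLead.monomial (k := k) (key := key) (e - ∑ i, monMult (m i) e • m i)).mul hkey
    (HasLead.prod hkey Finset.univ fun i => (hF i).pow hkey (monMult (m i) e))
  rwa [tsub_add_cancel_of_le (sum_monMult_le hd e)] at h

theorem stdMap_injective
    (hkey : ∀ a b c, key a < key b → key (a + c) < key (b + c))
    (hF : ∀ i, HasLead key (F i) (m i))
    (hd : Pairwise fun i j => Disjoint (m i).support (m j).support) :
    Function.Injective (stdMap F m) := by
  classical
  rw [← LinearMap.ker_eq_bot, LinearMap.ker_eq_bot']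
  intro g hg
  by_contra hne
  obtain ⟨e, he, hmax⟩ := Finset.exists_max_image g.support key (support_nonempty.2 hne)
  have h0 : coeff e (stdMap F m g) = coeff e g * coeff e (stdElt F m e) := by
    conv_lhs => rw [g.as_sum, map_sum, coeff_sum]
    rw [Finset.sum_eq_single e]
    · rw [← mul_one (coeff e g), ← smul_eq_mul, ← smul_monomial, map_smul, stdMap_monomial,
        coeff_smul]
      simp
    · intro a ha hae
      rw [← mul_one (coeff a g), ← smul_eq_mul, ← smul_monomial, map_smul, stdMap_monomial,
        coeff_smul]
      by_contra hc
      have : e ∈ (stdElt F m a).support := mem_support_iff.2 (right_ne_zero_of_mul hc)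
      rcases (stdElt_hasLead hkey hF hd a).2 e this with h | h
      · exact hae h.symm
      · exact absurd (hmax a ha) (not_le.2 h)
    · intro h; exact absurd he h
  rw [hg, coeff_zero] at h0
  have := (stdElt_hasLead hkey hF hd e).1.mul_left_eq_zero.1 h0.symm
  exact (mem_support_iff.1 he) this

theorem stdMap_surjective [WellFoundedLT Γ]
    (hkey : ∀ a b c, key a < key b → key (a + c) < key (b + c))
    (hF : ∀ i, HasLead key (F i) (m i))
    (hd : Pairwise fun i j => Disjoint (m i).support (m j).support) :
    Function.Surjective (stdMap F m) := by
  classical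
  rw [← LinearMap.range_eq_top]
  have h : ∀ γ, ∀ e, key e = γ → monomial e (1 : k) ∈ LinearMap.range (stdMap F m) := by
    intro γ
    induction γ using WellFoundedLT.induction with
    | _ γ ih =>
      intro e he
      obtain ⟨⟨u, hu⟩, hl⟩ := stdElt_hasLead hkey hF hd e
      set b := stdElt F m e with hb
      have hbm : b ∈ LinearMap.range (stdMap F m) := ⟨_, stdMap_monomial F m e⟩
      have h1 : b = coeff e b • monomial e (1 : k)
          + ∑ a ∈ b.support.erase e, coeff a b • monomial a (1 : k) := by
        have heb : e ∈ b.support ∨ coeff e b = 0 := by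
          by_cases h : coeff e b = 0
          · exact Or.inr h
          · exact Or.inl (mem_support_iff.2 h)
        have h2 : b = ∑ a ∈ b.support, coeff a b • monomial a (1 : k) := by
          conv_lhs => rw [b.as_sum]
          simp [smul_monomial]
        rcases heb with h | h
        · rw [Finset.add_sum_erase _ (fun a => coeff a b • monomial a (1 : k)) h]; exact h2
        · rw [Finset.erase_eq_of_notMem (by simpa using h), h, zero_smul, zero_add]; exact h2
      have h3 : ∑ a ∈ b.support.erase e, coeff a b • monomial a (1 : k)
          ∈ LinearMap.range (stdMap F m) := by
        refine Submodule.sum_mem _ fun a ha => Submodule.smul_mem _ _ ?_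
        obtain ⟨hae, ha⟩ := Finset.mem_erase.1 ha
        exact ih (key a) (he ▸ (hl a ha).resolve_left hae) a rfl
      have h4 : monomial e (1 : k) = (↑u⁻¹ : k) • (b
          - ∑ a ∈ b.support.erase e, coeff a b • monomial a (1 : k)) := by
        nth_rewrite 1 [h1]
        rw [add_sub_cancel_right, ← hu, smul_smul, Units.inv_mul, one_smul]
      rw [h4]
      exact Submodule.smul_mem _ _ (Submodule.sub_mem _ hbm h3)
  rw [eq_top_iff, ← (basisMonomials σ k).span_eq, Submodule.span_le]
  rintro _ ⟨e, rfl⟩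
  rw [coe_basisMonomials]
  exact h _ e rfl

theorem mem_span_of_mul_mem_of_fintype [WellFoundedLT Γ]
    (hkey : ∀ a b c, key a < key b → key (a + c) < key (b + c))
    (hF : ∀ i, HasLead key (F i) (m i))
    (hd : Pairwise fun i j => Disjoint (m i).support (m j).support)
    (hm : ∀ i, m i ≠ 0) {i : ι} {J : Set ι}
    (hi : i ∉ J) {a : MvPolynomial σ k} (ha : F i * a ∈ Ideal.span (F '' J)) :
    a ∈ Ideal.span (F '' J) := by
  classical
  have himage : ∀ g, stdMap F m g ∈ Ideal.span (F '' J) ↔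
      g ∈ Ideal.span ((fun s => monomial s (1 : k)) '' (m '' J)) := by
    intro g
    constructor
    · intro h
      have : ∀ x ∈ Ideal.span (F '' J),
          ∃ y ∈ Ideal.span ((fun s => monomial s (1 : k)) '' (m '' J)), stdMap F m y = x := by
        intro x hx
        refine Submodule.span_induction ?_ ⟨0, zero_mem _, map_zero _⟩ ?_ ?_ hx
        · rintro _ ⟨j, hj, rfl⟩
          obtain ⟨y, hy⟩ := stdMap_surjective hkey hF hd (1 : MvPolynomial σ k)
          refine ⟨monomial (m j) 1 * y, Ideal.mul_mem_right _ _
            (Ideal.subset_span ⟨m j, ⟨j, hj, rfl⟩, rfl⟩), ?_⟩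
          rw [stdMap_mul hm hd, hy, mul_one]
        · rintro _ _ _ _ ⟨y, hy, rfl⟩ ⟨z, hz, rfl⟩
          exact ⟨y + z, add_mem hy hz, map_add _ _ _⟩
        · rintro c x hx -
          rw [smul_eq_mul]
          revert c
          refine Submodule.span_induction ?_ ?_ ?_ ?_ hx
          · rintro _ ⟨j, hj, rfl⟩ c
            obtain ⟨y, hy⟩ := stdMap_surjective hkey hF hd c
            refine ⟨monomial (m j) 1 * y, Ideal.mul_mem_right _ _
              (Ideal.subset_span ⟨m j, ⟨j, hj, rfl⟩, rfl⟩), ?_⟩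
            rw [stdMap_mul hm hd, hy, mul_comm]
          · intro c
            exact ⟨0, zero_mem _, by simp⟩
          · intro x y _ _ hx hy c
            obtain ⟨x', hx', h1⟩ := hx c
            obtain ⟨y', hy', h2⟩ := hy c
            exact ⟨x' + y', add_mem hx' hy', by rw [map_add, h1, h2, mul_add]⟩
          · intro d x _ hx c
            obtain ⟨x', hx', h1⟩ := hx (c * d)
            exact ⟨x', hx', by rw [h1, smul_eq_mul, mul_assoc]⟩
      obtain ⟨y, hy, hyg⟩ := this _ h
      rwa [← stdMap_injective hkey hF hd hyg]
    · intro h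
      have : ∀ x ∈ Ideal.span ((fun s => monomial s (1 : k)) '' (m '' J)),
          ∀ c, stdMap F m (c * x) ∈ Ideal.span (F '' J) := by
        intro x hx
        refine Submodule.span_induction ?_ ?_ ?_ ?_ hx
        · rintro _ ⟨_, ⟨j, hj, rfl⟩, rfl⟩ c
          rw [mul_comm, stdMap_mul hm hd]
          exact Ideal.mul_mem_right _ _ (Ideal.subset_span ⟨j, hj, rfl⟩)
        · intro c
          simp
        · intro x y _ _ hx hy c
          rw [mul_add, map_add]
          exact add_mem (hx c) (hy c)
        · intro d x _ hx c
          rw [smul_eq_mul, ← mul_assoc]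
          exact hx _
      simpa using this _ h 1
  obtain ⟨g, rfl⟩ := stdMap_surjective hkey hF hd a
  rw [← stdMap_mul hm hd, himage, mem_ideal_span_monomial_image] at ha
  rw [himage, mem_ideal_span_monomial_image]
  intro e he
  have h1 : m i + e ∈ (monomial (m i) (1 : k) * g).support := by
    rw [mem_support_iff, coeff_monomial_mul, one_mul]
    exact mem_support_iff.1 he
  obtain ⟨_, ⟨j, hj, rfl⟩, hle⟩ := ha _ h1
  refine ⟨m j, ⟨j, hj, rfl⟩, fun s => ?_⟩
  by_cases hs : m j s = 0
  · simp [hs]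
  · have hij : i ≠ j := fun h => hi (h ▸ hj)
    have : m i s = 0 := by
      simpa using Finset.disjoint_left.1 (hd hij.symm) (by simpa using hs)
    simpa [this] using hle s

end Lead

/-- Polynomials with pairwise coprime leading monomials form a regular sequence in any order. -/
theorem mem_span_of_mul_mem {k σ Γ ι : Type*} [CommRing k] [LinearOrder Γ] [WellFoundedLT Γ]
    {key : (σ →₀ ℕ) → Γ} {F : ι → MvPolynomial σ k} {m : ι → σ →₀ ℕ}
    (hkey : ∀ a b c, key a < key b → key (a + c) < key (b + c))
    (hF : ∀ i, HasLead key (F i) (m i))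
    (hd : Pairwise fun i j => Disjoint (m i).support (m j).support)
    (hm : ∀ i, m i ≠ 0) {i : ι} {J : Set ι}
    (hi : i ∉ J) {a : MvPolynomial σ k} (ha : F i * a ∈ Ideal.span (F '' J)) :
    a ∈ Ideal.span (F '' J) := by
  classical
  obtain ⟨T, hT, haT⟩ := Submodule.mem_span_finite_of_mem_span ha
  obtain ⟨J', hJ', rfl⟩ := Finset.subset_set_image_iff.1 hT
  set F' : ↥(insert i J') → MvPolynomial σ k := fun j => F j
  have himg : F' '' {j | (j : ι) ∈ J'} = F '' (J' : Set ι) := by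
    ext x
    constructor
    · rintro ⟨⟨j, _⟩, hj, rfl⟩
      exact ⟨j, hj, rfl⟩
    · rintro ⟨j, hj, rfl⟩
      exact ⟨⟨j, Finset.mem_insert_of_mem hj⟩, hj, rfl⟩
  have h := mem_span_of_mul_mem_of_fintype hkey (F := F') (m := fun j => m j) (fun j => hF j)
    (fun j l hjl => hd (fun h => hjl (Subtype.ext h))) (fun j => hm j)
    (i := ⟨i, Finset.mem_insert_self _ _⟩) (J := {j | (j : ι) ∈ J'})
    (fun h => hi (hJ' h)) (a := a) (by rw [himg]; simpa [Ideal.span] using haT)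
  rw [himg] at h
  exact Ideal.span_mono (Set.image_mono hJ') h

section Key

variable {σ k : Type*} [CommRing k]

/-- Compare monomials by the weight `d`, then by the weight `n`, then inversely by the weight `w`;
the last entry is shifted so as to become nonnegative. -/
noncomputable def tripleKey (d n w : σ → ℕ) (K : ℕ) (e : σ →₀ ℕ) : ℕ ×ₗ ℕ ×ₗ ℕ :=
  toLex (Finsupp.weight d e, toLex (Finsupp.weight n e,
    K * (Finsupp.weight n e ^ 2 + Finsupp.weight d e) - Finsupp.weight w e))

variable {d n w : σ → ℕ} {K : ℕ}

theorem weight_le_of_le (h : ∀ s, w s ≤ K * (n s ^ 2 + d s)) (e : σ →₀ ℕ) :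
    Finsupp.weight w e ≤ K * (Finsupp.weight n e ^ 2 + Finsupp.weight d e) := by
  induction e using Finsupp.induction_linear with
  | zero => simp
  | add a b ha hb =>
    simp only [map_add]
    nlinarith [Nat.zero_le (K * (Finsupp.weight n a * Finsupp.weight n b))]
  | single s c =>
    simp only [Finsupp.weight_single, smul_eq_mul]
    rcases Nat.eq_zero_or_pos c with rfl | hc
    · simp
    · have h1 : c * n s ^ 2 ≤ (c * n s) ^ 2 := by
        rw [mul_pow]
        exact Nat.mul_le_mul_right _ (Nat.le_self_pow two_ne_zero c)
      calc c * w s ≤ c * (K * (n s ^ 2 + d s)) := Nat.mul_le_mul_left _ (h s)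
        _ = K * (c * n s ^ 2 + c * d s) := by ring
        _ ≤ _ := Nat.mul_le_mul_left _ (by omega)

theorem tripleKey_lt_iff (h : ∀ s, w s ≤ K * (n s ^ 2 + d s)) (a b : σ →₀ ℕ) :
    tripleKey d n w K a < tripleKey d n w K b ↔
      Finsupp.weight d a < Finsupp.weight d b ∨ Finsupp.weight d a = Finsupp.weight d b ∧
        (Finsupp.weight n a < Finsupp.weight n b ∨ Finsupp.weight n a = Finsupp.weight n b ∧
          Finsupp.weight w b < Finsupp.weight w a) := by
  have ha := weight_le_of_le h a
  have hb := weight_le_of_le h b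
  simp only [tripleKey, Prod.Lex.toLex_lt_toLex]
  refine or_congr Iff.rfl (and_congr_right fun h1 => or_congr Iff.rfl
    (and_congr_right fun h2 => ?_))
  rw [h1, h2] at ha ⊢
  omega

theorem tripleKey_add_lt (h : ∀ s, w s ≤ K * (n s ^ 2 + d s)) (a b c : σ →₀ ℕ)
    (hab : tripleKey d n w K a < tripleKey d n w K b) :
    tripleKey d n w K (a + c) < tripleKey d n w K (b + c) := by
  rw [tripleKey_lt_iff h] at *
  simp only [map_add]
  omega

end Key

section Lower

variable {σ k Γ : Type*} [CommRing k] [LT Γ] {key : (σ →₀ ℕ) → Γ}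

/-- The polynomials all of whose monomials have key below `γ`. -/
noncomputable def lowerSubmodule (k : Type*) [CommRing k] (key : (σ →₀ ℕ) → Γ) (γ : Γ) :
    Submodule k (MvPolynomial σ k) :=
  restrictSupport k {a | key a < γ}

theorem mem_lowerSubmodule {γ : Γ} {g : MvPolynomial σ k} :
    g ∈ lowerSubmodule k key γ ↔ ∀ a ∈ g.support, key a < γ :=
  mem_restrictSupport_iff k

theorem monomial_mem_lowerSubmodule {γ : Γ} {a : σ →₀ ℕ} (h : key a < γ) (c : k) :
    monomial a c ∈ lowerSubmodule k key γ := by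
  classical
  refine mem_lowerSubmodule.2 fun b hb => ?_
  rw [Finset.mem_singleton.1 (support_monomial_subset hb)]
  exact h

end Lower

section LowerMul

variable {σ k Γ : Type*} [CommRing k] [Preorder Γ] {key : (σ →₀ ℕ) → Γ}

theorem hasLead_of_sub_mem {g : MvPolynomial σ k} {e : σ →₀ ℕ} {c : k} (hc : IsUnit c)
    (h : g - monomial e c ∈ lowerSubmodule k key (key e)) : HasLead key g e := by
  classical
  have h1 : ∀ a, a ≠ e → coeff a g = coeff a (g - monomial e c) := fun a ha => by
    simp [coeff_monomial, ha.symm]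
  have h2 : coeff e (g - monomial e c) = 0 := by
    by_contra h3
    exact absurd (mem_lowerSubmodule.1 h e (mem_support_iff.2 h3)) (lt_irrefl (key e))
  refine ⟨?_, fun a ha => or_iff_not_imp_left.2 fun hae => mem_lowerSubmodule.1 h a ?_⟩
  · rw [coeff_sub, coeff_monomial, if_pos rfl, sub_eq_zero] at h2
    rwa [h2]
  · rw [mem_support_iff, h1 a hae] at ha
    exact mem_support_iff.2 ha

end LowerMul

/-- The three Gram entries `q_{ii}`, the three `q_{ij}` with `i < j`, and the determinant `c`
of a triple of vectors. -/
structure Gram (A : Type*) where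
  (q11 q22 q33 q23 q13 q12 c : A)

/-- Apply a map to all the entries. -/
def Gram.map {A B : Type*} (f : A → B) (g : Gram A) : Gram B :=
  ⟨f g.q11, f g.q22, f g.q33, f g.q23, f g.q13, f g.q12, f g.c⟩

/-- The relation between the Gram matrix and the determinant. -/
def Gram.rel {A : Type*} [CommRing A] (g : Gram A) : A :=
  g.q11 * g.q22 * g.q33 + 2 * (g.q23 * g.q13 * g.q12) - g.q11 * g.q23 * g.q23
    - g.q22 * g.q13 * g.q13 - g.q33 * g.q12 * g.q12 + 4 * (g.c * g.c)

theorem Gram.rel_map {A B : Type*} [CommRing A] [CommRing B] (f : A →+* B) (g : Gram A) :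
    (g.map f).rel = f g.rel := by
  have h2 : f 2 = 2 := map_ofNat f 2
  have h4 : f 4 = 4 := map_ofNat f 4
  simp [Gram.rel, Gram.map, h2, h4]

section MonomialSeries

variable {σ k Γ : Type*} [CommRing k] [LT Γ] {key : (σ →₀ ℕ) → Γ}

/-- A power series all of whose coefficients are terms. -/
noncomputable def termSeries (a : ℕ → σ →₀ ℕ) (α : ℕ → k) : PowerSeries (MvPolynomial σ k) :=
  PowerSeries.mk fun i => monomial (a i) (α i)

variable {a b c : ℕ → σ →₀ ℕ} {α β γ : ℕ → k}

theorem coeff_termSeries_mul (n : ℕ) :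
    PowerSeries.coeff n (termSeries a α * termSeries b β) =
      ∑ x ∈ Finset.HasAntidiagonal.antidiagonal n, monomial (a x.1 + b x.2) (α x.1 * β x.2) := by
  simp [PowerSeries.coeff_mul, termSeries, monomial_mul]

theorem coeff_termSeries_mul_mul (n : ℕ) :
    PowerSeries.coeff n (termSeries a α * termSeries b β * termSeries c γ) =
      ∑ x ∈ (Finset.HasAntidiagonal.antidiagonal n).sigma
          fun x => Finset.HasAntidiagonal.antidiagonal x.1,
        monomial (a x.2.1 + b x.2.2 + c x.1.2) (α x.2.1 * β x.2.2 * γ x.1.2) := by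
  rw [PowerSeries.coeff_mul, Finset.sum_sigma]
  refine Finset.sum_congr rfl fun x _ => ?_
  rw [coeff_termSeries_mul, Finset.sum_mul]
  simp [termSeries, monomial_mul]

theorem coeff_mul_mem_lower {n : ℕ} {e : Γ} (h : ∀ i j, i + j = n → key (a i + b j) < e) :
    PowerSeries.coeff n (termSeries a α * termSeries b β) ∈ lowerSubmodule k key e := by
  rw [coeff_termSeries_mul]
  exact Submodule.sum_mem _ fun x hx =>
    monomial_mem_lowerSubmodule (h _ _ (Finset.HasAntidiagonal.mem_antidiagonal.1 hx)) _

theorem coeff_mul_mul_mem_lower {n : ℕ} {e : Γ}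
    (h : ∀ i j l, i + j + l = n → key (a i + b j + c l) < e) :
    PowerSeries.coeff n (termSeries a α * termSeries b β * termSeries c γ) ∈
      lowerSubmodule k key e := by
  rw [coeff_termSeries_mul_mul]
  refine Submodule.sum_mem _ fun x hx => monomial_mem_lowerSubmodule (h _ _ _ ?_) _
  simp only [Finset.mem_sigma, Finset.HasAntidiagonal.mem_antidiagonal] at hx
  omega

theorem coeff_mul_sub_mem_lower {n i₀ j₀ : ℕ} (h₀ : i₀ + j₀ = n) {e : Γ}
    (h : ∀ i j, i + j = n → i ≠ i₀ → key (a i + b j) < e) :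
    PowerSeries.coeff n (termSeries a α * termSeries b β)
      - monomial (a i₀ + b j₀) (α i₀ * β j₀) ∈ lowerSubmodule k key e := by
  classical
  rw [coeff_termSeries_mul, ← Finset.add_sum_erase _ _
    (show (i₀, j₀) ∈ Finset.HasAntidiagonal.antidiagonal n by simpa using h₀), add_sub_cancel_left]
  refine Submodule.sum_mem _ fun x hx => monomial_mem_lowerSubmodule (h _ _ ?_ ?_) _
  · simpa using (Finset.mem_erase.1 hx).2
  · have h1 : x.1 + x.2 = n := by simpa using (Finset.mem_erase.1 hx).2
    have h2 := (Finset.mem_erase.1 hx).1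
    contrapose! h2
    ext <;> simp <;> omega

theorem coeff_mul_mul_sub_mem_lower {n i₀ j₀ l₀ : ℕ} (h₀ : i₀ + j₀ + l₀ = n) {e : Γ}
    (h : ∀ i j l, i + j + l = n → i ≠ i₀ ∨ j ≠ j₀ → key (a i + b j + c l) < e) :
    PowerSeries.coeff n (termSeries a α * termSeries b β * termSeries c γ)
      - monomial (a i₀ + b j₀ + c l₀) (α i₀ * β j₀ * γ l₀) ∈ lowerSubmodule k key e := by
  classical
  rw [coeff_termSeries_mul_mul, ← Finset.add_sum_erase _ _
    (show (⟨(i₀ + j₀, l₀), (i₀, j₀)⟩ : (_ : ℕ × ℕ) × ℕ × ℕ) ∈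
      (Finset.HasAntidiagonal.antidiagonal n).sigma
        fun x => Finset.HasAntidiagonal.antidiagonal x.1 by simpa using h₀),
    add_sub_cancel_left]
  refine Submodule.sum_mem _ fun x hx => monomial_mem_lowerSubmodule ?_ _
  obtain ⟨⟨p, q⟩, ⟨i, j⟩⟩ := x
  simp only [Finset.mem_erase, Finset.mem_sigma, Finset.HasAntidiagonal.mem_antidiagonal] at hx
  obtain ⟨hne, h1, h2⟩ := hx
  refine h _ _ _ (by simp only; omega) ?_
  by_contra! h3
  obtain ⟨rfl, rfl⟩ := h3
  have h4 : q = l₀ := by simp only at *; omega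
  subst h4
  have h5 : p = i + j := by simp only at *; omega
  subst h5
  exact hne rfl

end MonomialSeries

/-- Index set for the coefficients of the entries of a `Gram` of power series. -/
abbrev GramVar : Type := Fin 4 × ℕ ⊕ Fin 3 × ℕ

/-- The `Gram` of power series with indeterminate coefficients. -/
noncomputable def genGram : Gram (PowerSeries (MvPolynomial GramVar ℂ)) where
  q22 := PowerSeries.mk fun n => X (.inl (0, n))
  q33 := PowerSeries.mk fun n => X (.inl (1, n))
  q23 := PowerSeries.mk fun n => X (.inl (2, n))
  c := PowerSeries.mk fun n => X (.inl (3, n))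
  q11 := PowerSeries.mk fun n => X (.inr (0, n))
  q13 := PowerSeries.mk fun n => X (.inr (1, n))
  q12 := PowerSeries.mk fun n => X (.inr (2, n))

theorem mk_X_eq_termSeries {σ k : Type*} [CommRing k] (a : ℕ → σ) :
    (PowerSeries.mk fun n => X (a n) : PowerSeries (MvPolynomial σ k)) =
      termSeries (fun n => Finsupp.single (a n) 1) fun _ => 1 := rfl

section FullKey

/-- Polynomial degree of the Gram entries. -/
def fullDeg : GramVar → ℕ :=
  Sum.elim (fun p => ![2, 2, 2, 3] p.1) fun _ => 2

/-- Jet order. -/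
def fullOrd : GramVar → ℕ := Sum.elim Prod.snd Prod.snd

/-- Weights selecting the cubic terms `q22 q13²`, `q11 q23²`, `q33 q12²` of the relation. -/
def fullWt : GramVar → ℕ :=
  Sum.elim
    (fun p => ![5 * p.2 ^ 2 + 8 * p.2 + 1, 5 * p.2 ^ 2 + 14 * p.2 + 4, 5 * p.2 ^ 2 + 11 * p.2 + 2,
      4 * p.2 ^ 2 + 8 * p.2 + 1] p.1)
    fun p => ![5 * p.2 ^ 2 + 1, 5 * p.2 ^ 2 + 7 * p.2, 5 * p.2 ^ 2 + 4 * p.2] p.1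

theorem fullWt_le (s : GramVar) : fullWt s ≤ 20 * (fullOrd s ^ 2 + fullDeg s) := by
  rcases s with ⟨i, n⟩ | ⟨i, n⟩ <;> fin_cases i <;>
    simp [fullWt, fullOrd, fullDeg] <;> nlinarith [Nat.le_self_pow two_ne_zero n]

/-- The monomial order used for the relations over `ℂ`. -/
noncomputable def fullKey : (GramVar →₀ ℕ) → ℕ ×ₗ ℕ ×ₗ ℕ := tripleKey fullDeg fullOrd fullWt 20

theorem fullKey_add_lt (a b c : GramVar →₀ ℕ) (h : fullKey a < fullKey b) :
    fullKey (a + c) < fullKey (b + c) := tripleKey_add_lt fullWt_le a b c h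

/-- A product of two consecutive integers is nonnegative. -/
theorem consecutive_mul_nonneg (t k : ℤ) : 0 ≤ (t - k) * (t - k - 1) := by
  rcases le_or_gt t k with h | h
  · exact mul_nonneg_of_nonpos_of_nonpos (by omega) (by omega)
  · exact mul_nonneg (by omega) (by omega)

theorem exists_shift {i j l m r : ℕ} (h : i + j + l = 3 * m + r) :
    ∃ a b : ℤ, (i : ℤ) = m + a ∧ (j : ℤ) = m + b ∧ (l : ℤ) = r + m - a - b :=
  ⟨i - m, j - m, by ring, by ring, by omega⟩

/-- Coefficients of the relation of `genGram`, as combinations of products of term series. -/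
theorem coeff_rel_genGram (n : ℕ) :
    PowerSeries.coeff n genGram.rel =
      PowerSeries.coeff n (genGram.q11 * genGram.q22 * genGram.q33)
        + (2 : ℂ) • PowerSeries.coeff n (genGram.q23 * genGram.q13 * genGram.q12)
        - PowerSeries.coeff n (genGram.q11 * genGram.q23 * genGram.q23)
        - PowerSeries.coeff n (genGram.q22 * genGram.q13 * genGram.q13)
        - PowerSeries.coeff n (genGram.q33 * genGram.q12 * genGram.q12)
        + (4 : ℂ) • PowerSeries.coeff n (genGram.c * genGram.c) := by
  have e1 : (2 : PowerSeries (MvPolynomial GramVar ℂ)) = PowerSeries.C (C 2) := by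
    rw [map_ofNat C 2, map_ofNat PowerSeries.C 2]
  have e2 : (4 : PowerSeries (MvPolynomial GramVar ℂ)) = PowerSeries.C (C 4) := by
    rw [map_ofNat C 4, map_ofNat PowerSeries.C 4]
  rw [Gram.rel, e1, e2]
  simp only [map_add, map_sub, PowerSeries.coeff_C_mul, C_mul']

set_option maxHeartbeats 1000000 in
theorem hasLead_rel_three_mul (m : ℕ) :
    HasLead fullKey (PowerSeries.coeff (3 * m) genGram.rel)
      (Finsupp.single (.inl (0, m)) 1 + Finsupp.single (.inr (1, m)) 1
        + Finsupp.single (.inr (1, m)) 1) := by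
  have H := consecutive_mul_nonneg
  refine hasLead_of_sub_mem (c := -(1 * 1 * 1)) (by simp) ?_
  rw [coeff_rel_genGram, map_neg, sub_neg_eq_add]
  simp only [genGram, mk_X_eq_termSeries]
  have aux : ∀ a b c d e f g : MvPolynomial GramVar ℂ,
      a + b - c - d - e + f + g = a + b - c - (d - g) - e + f := fun _ _ _ _ _ _ _ => by ring
  rw [aux]
  refine Submodule.add_mem _ (Submodule.sub_mem _ (Submodule.sub_mem _ (Submodule.sub_mem _
    (Submodule.add_mem _ (coeff_mul_mul_mem_lower fun i j l h => ?_)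
      (Submodule.smul_mem _ _ (coeff_mul_mul_mem_lower fun i j l h => ?_)))
      (coeff_mul_mul_mem_lower fun i j l h => ?_))
      (coeff_mul_mul_sub_mem_lower (by omega) fun i j l h h => ?_))
      (coeff_mul_mul_mem_lower fun i j l h => ?_))
    (Submodule.smul_mem _ _ (coeff_mul_mem_lower fun i j h => ?_))
  all_goals
    refine (tripleKey_lt_iff fullWt_le _ _).2 (Or.inr ⟨?_, Or.inr ⟨?_, ?_⟩⟩) <;>
    simp [Finsupp.weight_single, fullWt, fullOrd, fullDeg]
  all_goals try omega
  · obtain ⟨a, b, hi, hj, hl⟩ := exists_shift (m := m) (r := 0) (by assumption)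
    have Ha := H a
    have Hb := H b
    have Hc := H (a + b)
    zify
    rw [hi, hj, hl]
    push_cast
    linarith [Ha (-3), Ha (-2), Ha (-1), Ha 0, Ha 1, Ha 2, Hb (-3), Hb (-2), Hb (-1), Hb 0,
      Hb 1, Hb 2, Hc (-3), Hc (-2), Hc (-1), Hc 0, Hc 1, Hc 2]
  · obtain ⟨a, b, hi, hj, hl⟩ := exists_shift (m := m) (r := 0) (by assumption)
    have Ha := H a
    have Hb := H b
    have Hc := H (a + b)
    zify
    rw [hi, hj, hl]
    push_cast
    linarith [Ha (-3), Ha (-2), Ha (-1), Ha 0, Ha 1, Ha 2, Hb (-3), Hb (-2), Hb (-1), Hb 0,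
      Hb 1, Hb 2, Hc (-3), Hc (-2), Hc (-1), Hc 0, Hc 1, Hc 2]
  · obtain ⟨a, b, hi, hj, hl⟩ := exists_shift (m := m) (r := 0) (by assumption)
    have Ha := H a
    have Hb := H b
    have Hc := H (a + b)
    zify
    rw [hi, hj, hl]
    push_cast
    linarith [Ha (-3), Ha (-2), Ha (-1), Ha 0, Ha 1, Ha 2, Hb (-3), Hb (-2), Hb (-1), Hb 0,
      Hb 1, Hb 2, Hc (-3), Hc (-2), Hc (-1), Hc 0, Hc 1, Hc 2]
  · obtain ⟨a, b, hi, hj, hl⟩ := exists_shift (m := m) (r := 0) (by assumption)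
    have Ha := H a
    have Hb := H b
    have Hc := H (a + b)
    zify
    rw [hi, hj, hl]
    push_cast
    have h' : a ≤ -1 ∨ 1 ≤ a ∨ b ≤ -1 ∨ 1 ≤ b := by omega
    rcases h' with h' | h' | h' | h' <;>
    linarith [Ha (-3), Ha (-2), Ha (-1), Ha 0, Ha 1, Ha 2, Hb (-3), Hb (-2), Hb (-1), Hb 0,
      Hb 1, Hb 2, Hc (-3), Hc (-2), Hc (-1), Hc 0, Hc 1, Hc 2]
  · obtain ⟨a, b, hi, hj, hl⟩ := exists_shift (m := m) (r := 0) (by assumption)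
    have Ha := H a
    have Hb := H b
    have Hc := H (a + b)
    zify
    rw [hi, hj, hl]
    push_cast
    linarith [Ha (-3), Ha (-2), Ha (-1), Ha 0, Ha 1, Ha 2, Hb (-3), Hb (-2), Hb (-1), Hb 0,
      Hb 1, Hb 2, Hc (-3), Hc (-2), Hc (-1), Hc 0, Hc 1, Hc 2]
  · zify
    have h' : (j : ℤ) = 3 * m + 0 - i := by omega
    rw [h']
    nlinarith [sq_nonneg (2 * (i : ℤ) - 3 * m - 0)]

set_option maxHeartbeats 1000000 in
theorem hasLead_rel_three_mul_add_one (m : ℕ) :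
    HasLead fullKey (PowerSeries.coeff (3 * m + 1) genGram.rel)
      (Finsupp.single (.inr (0, m + 1)) 1 + Finsupp.single (.inl (2, m)) 1
        + Finsupp.single (.inl (2, m)) 1) := by
  have H := consecutive_mul_nonneg
  refine hasLead_of_sub_mem (c := -(1 * 1 * 1)) (by simp) ?_
  rw [coeff_rel_genGram, map_neg, sub_neg_eq_add]
  simp only [genGram, mk_X_eq_termSeries]
  have aux : ∀ a b c d e f g : MvPolynomial GramVar ℂ,
      a + b - c - d - e + f + g = a + b - (c - g) - d - e + f := fun _ _ _ _ _ _ _ => by ring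
  rw [aux]
  refine Submodule.add_mem _ (Submodule.sub_mem _ (Submodule.sub_mem _ (Submodule.sub_mem _
    (Submodule.add_mem _ (coeff_mul_mul_mem_lower fun i j l h => ?_)
      (Submodule.smul_mem _ _ (coeff_mul_mul_mem_lower fun i j l h => ?_)))
      (coeff_mul_mul_sub_mem_lower (by omega) fun i j l h h => ?_))
      (coeff_mul_mul_mem_lower fun i j l h => ?_))
      (coeff_mul_mul_mem_lower fun i j l h => ?_))
    (Submodule.smul_mem _ _ (coeff_mul_mem_lower fun i j h => ?_))
  all_goals
    refine (tripleKey_lt_iff fullWt_le _ _).2 (Or.inr ⟨?_, Or.inr ⟨?_, ?_⟩⟩) <;>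
    simp [Finsupp.weight_single, fullWt, fullOrd, fullDeg]
  all_goals try omega
  · obtain ⟨a, b, hi, hj, hl⟩ := exists_shift (m := m) (r := 1) (by assumption)
    have Ha := H a
    have Hb := H b
    have Hc := H (a + b)
    zify
    rw [hi, hj, hl]
    push_cast
    linarith [Ha (-3), Ha (-2), Ha (-1), Ha 0, Ha 1, Ha 2, Hb (-3), Hb (-2), Hb (-1), Hb 0,
      Hb 1, Hb 2, Hc (-3), Hc (-2), Hc (-1), Hc 0, Hc 1, Hc 2]
  · obtain ⟨a, b, hi, hj, hl⟩ := exists_shift (m := m) (r := 1) (by assumption)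
    have Ha := H a
    have Hb := H b
    have Hc := H (a + b)
    zify
    rw [hi, hj, hl]
    push_cast
    linarith [Ha (-3), Ha (-2), Ha (-1), Ha 0, Ha 1, Ha 2, Hb (-3), Hb (-2), Hb (-1), Hb 0,
      Hb 1, Hb 2, Hc (-3), Hc (-2), Hc (-1), Hc 0, Hc 1, Hc 2]
  · obtain ⟨a, b, hi, hj, hl⟩ := exists_shift (m := m) (r := 1) (by assumption)
    have Ha := H a
    have Hb := H b
    have Hc := H (a + b)
    zify
    rw [hi, hj, hl]
    push_cast
    have h' : a ≤ 0 ∨ 2 ≤ a ∨ b ≤ -1 ∨ 1 ≤ b := by omega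
    rcases h' with h' | h' | h' | h' <;>
    linarith [Ha (-3), Ha (-2), Ha (-1), Ha 0, Ha 1, Ha 2, Hb (-3), Hb (-2), Hb (-1), Hb 0,
      Hb 1, Hb 2, Hc (-3), Hc (-2), Hc (-1), Hc 0, Hc 1, Hc 2]
  · obtain ⟨a, b, hi, hj, hl⟩ := exists_shift (m := m) (r := 1) (by assumption)
    have Ha := H a
    have Hb := H b
    have Hc := H (a + b)
    zify
    rw [hi, hj, hl]
    push_cast
    linarith [Ha (-3), Ha (-2), Ha (-1), Ha 0, Ha 1, Ha 2, Hb (-3), Hb (-2), Hb (-1), Hb 0,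
      Hb 1, Hb 2, Hc (-3), Hc (-2), Hc (-1), Hc 0, Hc 1, Hc 2]
  · obtain ⟨a, b, hi, hj, hl⟩ := exists_shift (m := m) (r := 1) (by assumption)
    have Ha := H a
    have Hb := H b
    have Hc := H (a + b)
    zify
    rw [hi, hj, hl]
    push_cast
    linarith [Ha (-3), Ha (-2), Ha (-1), Ha 0, Ha 1, Ha 2, Hb (-3), Hb (-2), Hb (-1), Hb 0,
      Hb 1, Hb 2, Hc (-3), Hc (-2), Hc (-1), Hc 0, Hc 1, Hc 2]
  · zify
    have h' : (j : ℤ) = 3 * m + 1 - i := by omega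
    rw [h']
    nlinarith [sq_nonneg (2 * (i : ℤ) - 3 * m - 1)]

set_option maxHeartbeats 1000000 in
theorem hasLead_rel_three_mul_add_two (m : ℕ) :
    HasLead fullKey (PowerSeries.coeff (3 * m + 2) genGram.rel)
      (Finsupp.single (.inl (1, m)) 1 + Finsupp.single (.inr (2, m + 1)) 1
        + Finsupp.single (.inr (2, m + 1)) 1) := by
  have H := consecutive_mul_nonneg
  refine hasLead_of_sub_mem (c := -(1 * 1 * 1)) (by simp) ?_
  rw [coeff_rel_genGram, map_neg, sub_neg_eq_add]
  simp only [genGram, mk_X_eq_termSeries]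
  have aux : ∀ a b c d e f g : MvPolynomial GramVar ℂ,
      a + b - c - d - e + f + g = a + b - c - d - (e - g) + f := fun _ _ _ _ _ _ _ => by ring
  rw [aux]
  refine Submodule.add_mem _ (Submodule.sub_mem _ (Submodule.sub_mem _ (Submodule.sub_mem _
    (Submodule.add_mem _ (coeff_mul_mul_mem_lower fun i j l h => ?_)
      (Submodule.smul_mem _ _ (coeff_mul_mul_mem_lower fun i j l h => ?_)))
      (coeff_mul_mul_mem_lower fun i j l h => ?_))
      (coeff_mul_mul_mem_lower fun i j l h => ?_))
      (coeff_mul_mul_sub_mem_lower (by omega) fun i j l h h => ?_))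
    (Submodule.smul_mem _ _ (coeff_mul_mem_lower fun i j h => ?_))
  all_goals
    refine (tripleKey_lt_iff fullWt_le _ _).2 (Or.inr ⟨?_, Or.inr ⟨?_, ?_⟩⟩) <;>
    simp [Finsupp.weight_single, fullWt, fullOrd, fullDeg]
  all_goals try omega
  · obtain ⟨a, b, hi, hj, hl⟩ := exists_shift (m := m) (r := 2) (by assumption)
    have Ha := H a
    have Hb := H b
    have Hc := H (a + b)
    zify
    rw [hi, hj, hl]
    push_cast
    linarith [Ha (-3), Ha (-2), Ha (-1), Ha 0, Ha 1, Ha 2, Hb (-3), Hb (-2), Hb (-1), Hb 0,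
      Hb 1, Hb 2, Hc (-3), Hc (-2), Hc (-1), Hc 0, Hc 1, Hc 2]
  · obtain ⟨a, b, hi, hj, hl⟩ := exists_shift (m := m) (r := 2) (by assumption)
    have Ha := H a
    have Hb := H b
    have Hc := H (a + b)
    zify
    rw [hi, hj, hl]
    push_cast
    linarith [Ha (-3), Ha (-2), Ha (-1), Ha 0, Ha 1, Ha 2, Hb (-3), Hb (-2), Hb (-1), Hb 0,
      Hb 1, Hb 2, Hc (-3), Hc (-2), Hc (-1), Hc 0, Hc 1, Hc 2]
  · obtain ⟨a, b, hi, hj, hl⟩ := exists_shift (m := m) (r := 2) (by assumption)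
    have Ha := H a
    have Hb := H b
    have Hc := H (a + b)
    zify
    rw [hi, hj, hl]
    push_cast
    linarith [Ha (-3), Ha (-2), Ha (-1), Ha 0, Ha 1, Ha 2, Hb (-3), Hb (-2), Hb (-1), Hb 0,
      Hb 1, Hb 2, Hc (-3), Hc (-2), Hc (-1), Hc 0, Hc 1, Hc 2]
  · obtain ⟨a, b, hi, hj, hl⟩ := exists_shift (m := m) (r := 2) (by assumption)
    have Ha := H a
    have Hb := H b
    have Hc := H (a + b)
    zify
    rw [hi, hj, hl]
    push_cast
    linarith [Ha (-3), Ha (-2), Ha (-1), Ha 0, Ha 1, Ha 2, Hb (-3), Hb (-2), Hb (-1), Hb 0,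
      Hb 1, Hb 2, Hc (-3), Hc (-2), Hc (-1), Hc 0, Hc 1, Hc 2]
  · obtain ⟨a, b, hi, hj, hl⟩ := exists_shift (m := m) (r := 2) (by assumption)
    have Ha := H a
    have Hb := H b
    have Hc := H (a + b)
    zify
    rw [hi, hj, hl]
    push_cast
    have h' : a ≤ -1 ∨ 1 ≤ a ∨ b ≤ 0 ∨ 2 ≤ b := by omega
    rcases h' with h' | h' | h' | h' <;>
    linarith [Ha (-3), Ha (-2), Ha (-1), Ha 0, Ha 1, Ha 2, Hb (-3), Hb (-2), Hb (-1), Hb 0,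
      Hb 1, Hb 2, Hc (-3), Hc (-2), Hc (-1), Hc 0, Hc 1, Hc 2]
  · zify
    have h' : (j : ℤ) = 3 * m + 2 - i := by omega
    rw [h']
    nlinarith [sq_nonneg (2 * (i : ℤ) - 3 * m - 2)]

theorem pairwise_disjoint_support_of_owner {σ ι : Type*} {m : ι → σ →₀ ℕ} (own : σ → ι)
    (h : ∀ i s, m i s ≠ 0 → own s = i) :
    Pairwise fun i j => Disjoint (m i).support (m j).support := by
  intro i j hij
  refine Finset.disjoint_left.2 fun s hi hj => hij ?_
  rw [← h i s (by simpa using hi), ← h j s (by simpa using hj)]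

/-- The ideal of coefficients of the relation of `genGram`. -/
noncomputable def relIdeal : Ideal (MvPolynomial GramVar ℂ) :=
  Ideal.span (Set.range fun k => PowerSeries.coeff k genGram.rel)

theorem hasLead_q11 : HasLead fullKey (X (.inr (0, 0)) : MvPolynomial GramVar ℂ)
    (Finsupp.single (.inr (0, 0)) 1) := HasLead.monomial _

theorem hasLead_q11_add : HasLead fullKey
    (X (.inr (0, 0)) + 2 * X (.inr (2, 0)) + X (.inl (0, 0)) : MvPolynomial GramVar ℂ)
    (Finsupp.single (.inr (2, 0)) 1) := by
  refine hasLead_of_sub_mem (c := 2) (by simp) ?_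
  have h : (2 * X (.inr (2, 0)) : MvPolynomial GramVar ℂ)
      = monomial (Finsupp.single (.inr (2, 0)) 1) 2 := by
    rw [← map_ofNat C 2, C_mul_X_eq_monomial]
  rw [h, add_right_comm, add_sub_cancel_right]
  refine Submodule.add_mem _ (monomial_mem_lowerSubmodule ?_ _) (monomial_mem_lowerSubmodule ?_ _)
  all_goals
    refine (tripleKey_lt_iff fullWt_le _ _).2 (Or.inr ⟨?_, Or.inr ⟨?_, ?_⟩⟩) <;>
    simp [Finsupp.weight_single, fullWt, fullOrd, fullDeg]

/-- The relations together with two further elements. -/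
noncomputable def fullSeq : Fin 2 ⊕ ℕ × Fin 3 → MvPolynomial GramVar ℂ :=
  Sum.elim ![X (.inr (0, 0)), X (.inr (0, 0)) + 2 * X (.inr (2, 0)) + X (.inl (0, 0))]
    fun p => PowerSeries.coeff (3 * p.1 + p.2) genGram.rel

/-- The leading exponents of `fullSeq`. -/
noncomputable def fullLead : Fin 2 ⊕ ℕ × Fin 3 → GramVar →₀ ℕ :=
  Sum.elim ![Finsupp.single (.inr (0, 0)) 1, Finsupp.single (.inr (2, 0)) 1] fun p =>
    ![Finsupp.single (.inl (0, p.1)) 1 + Finsupp.single (.inr (1, p.1)) 1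
        + Finsupp.single (.inr (1, p.1)) 1,
      Finsupp.single (.inr (0, p.1 + 1)) 1 + Finsupp.single (.inl (2, p.1)) 1
        + Finsupp.single (.inl (2, p.1)) 1,
      Finsupp.single (.inl (1, p.1)) 1 + Finsupp.single (.inr (2, p.1 + 1)) 1
        + Finsupp.single (.inr (2, p.1 + 1)) 1] p.2

/-- The index of the element of `fullSeq` whose leading exponent involves a given variable. -/
def fullOwner : GramVar → Fin 2 ⊕ ℕ × Fin 3
  | .inl (0, m) => .inr (m, 0)
  | .inl (1, m) => .inr (m, 2)
  | .inl (2, m) => .inr (m, 1)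
  | .inl (3, _) => .inl 0
  | .inr (0, 0) => .inl 0
  | .inr (0, m + 1) => .inr (m, 1)
  | .inr (1, m) => .inr (m, 0)
  | .inr (2, 0) => .inl 1
  | .inr (2, m + 1) => .inr (m, 2)

theorem fullSeq_hasLead (i : Fin 2 ⊕ ℕ × Fin 3) : HasLead fullKey (fullSeq i) (fullLead i) := by
  rcases i with i | ⟨m, i⟩ <;> fin_cases i
  · exact hasLead_q11
  · exact hasLead_q11_add
  · exact hasLead_rel_three_mul m
  · exact hasLead_rel_three_mul_add_one m
  · exact hasLead_rel_three_mul_add_two m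

theorem fullLead_owner (i : Fin 2 ⊕ ℕ × Fin 3) (s : GramVar) (h : fullLead i s ≠ 0) :
    fullOwner s = i := by
  classical
  rcases i with i | ⟨m, i⟩ <;> fin_cases i
  all_goals
    by_contra hc
    apply h
    simp [fullLead]
  all_goals try refine ⟨?_, ?_⟩
  all_goals
    refine Finsupp.single_eq_of_ne ?_
    rintro rfl
    exact hc rfl

theorem fullLead_ne_zero (i : Fin 2 ⊕ ℕ × Fin 3) : fullLead i ≠ 0 := by
  intro h
  have h' := congrArg (Finsupp.weight fullDeg) h
  rcases i with i | ⟨m, i⟩ <;> fin_cases i <;>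
    simp [fullLead, fullDeg, Finsupp.weight_single] at h'

theorem fullSeq_image_range_inr : fullSeq '' Set.range Sum.inr =
    Set.range fun k => PowerSeries.coeff k genGram.rel := by
  ext x
  constructor
  · rintro ⟨_, ⟨p, rfl⟩, rfl⟩
    exact ⟨_, rfl⟩
  · rintro ⟨k, rfl⟩
    refine ⟨_, ⟨(k / 3, ⟨k % 3, Nat.mod_lt _ (by norm_num)⟩), rfl⟩, ?_⟩
    simp only [fullSeq, Sum.elim_inr]
    rw [Nat.div_add_mod]

theorem mem_relIdeal_of_q11_mul_mem {a : MvPolynomial GramVar ℂ}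
    (h : X (.inr (0, 0)) * a ∈ relIdeal) : a ∈ relIdeal := by
  rw [relIdeal, ← fullSeq_image_range_inr] at *
  exact mem_span_of_mul_mem fullKey_add_lt fullSeq_hasLead
    (pairwise_disjoint_support_of_owner fullOwner fullLead_owner) fullLead_ne_zero
    (i := .inl 0) (by simp) h

theorem mem_of_q11_add_mul_mem {a : MvPolynomial GramVar ℂ}
    (h : (X (.inr (0, 0)) + 2 * X (.inr (2, 0)) + X (.inl (0, 0))) * a ∈
      Ideal.span {X (.inr (0, 0))} ⊔ relIdeal) :
    a ∈ Ideal.span {X (.inr (0, 0))} ⊔ relIdeal := by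
  have e : Ideal.span {X (.inr (0, 0))} ⊔ relIdeal =
      Ideal.span (fullSeq '' insert (.inl 0) (Set.range Sum.inr)) := by
    rw [Set.image_insert_eq, fullSeq_image_range_inr, Ideal.span_insert]
    rfl
  rw [e] at h ⊢
  exact mem_span_of_mul_mem fullKey_add_lt fullSeq_hasLead
    (pairwise_disjoint_support_of_owner fullOwner fullLead_owner) fullLead_ne_zero
    (i := .inl 1) (by simp) h

/-- The `Gram` of power series over a polynomial ring with `q11`, `q13`, `q12` prescribed in the
coefficient ring and the other entries indeterminate. -/
noncomputable def partGram {k : Type*} [CommRing k] (D v w : ℕ → k) :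
    Gram (PowerSeries (MvPolynomial (Fin 4 × ℕ) k)) where
  q22 := PowerSeries.mk fun n => X (0, n)
  q33 := PowerSeries.mk fun n => X (1, n)
  q23 := PowerSeries.mk fun n => X (2, n)
  c := PowerSeries.mk fun n => X (3, n)
  q11 := PowerSeries.mk fun n => C (D n)
  q13 := PowerSeries.mk fun n => C (v n)
  q12 := PowerSeries.mk fun n => C (w n)

theorem mk_C_eq_termSeries {σ k : Type*} [CommRing k] (a : ℕ → k) :
    (PowerSeries.mk fun n => C (a n) : PowerSeries (MvPolynomial σ k)) =
      termSeries (fun _ => 0) a := rfl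

/-- Polynomial degree. -/
def partDeg : Fin 4 × ℕ → ℕ := fun _ => 1

/-- Weights selecting the quadratic terms `c²` and `q22 q33` of the relation. -/
def partWt : Fin 4 × ℕ → ℕ := fun p =>
  ![6 * p.2 ^ 2 + 12 * p.2 + 2, 6 * p.2 ^ 2 + 2, 6 * p.2 ^ 2 + 6 * p.2 + 1,
    6 * p.2 ^ 2 + 6 * p.2] p.1

theorem partWt_le (s : Fin 4 × ℕ) : partWt s ≤ 20 * (s.2 ^ 2 + partDeg s) := by
  obtain ⟨i, n⟩ := s
  fin_cases i <;> simp [partWt, partDeg] <;> nlinarith [Nat.le_self_pow two_ne_zero n]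

/-- The monomial order used for the relations once `q11` is invertible. -/
noncomputable def partKey : (Fin 4 × ℕ →₀ ℕ) → ℕ ×ₗ ℕ ×ₗ ℕ :=
  tripleKey partDeg Prod.snd partWt 20

theorem partKey_add_lt (a b c : Fin 4 × ℕ →₀ ℕ) (h : partKey a < partKey b) :
    partKey (a + c) < partKey (b + c) := tripleKey_add_lt partWt_le a b c h

variable {k : Type*} [CommRing k] (D v w : ℕ → k)

theorem coeff_rel_partGram (n : ℕ) :
    PowerSeries.coeff n (partGram D v w).rel =
      PowerSeries.coeff n ((partGram D v w).q11 * (partGram D v w).q22 * (partGram D v w).q33)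
        + (2 : k) • PowerSeries.coeff n
          ((partGram D v w).q23 * (partGram D v w).q13 * (partGram D v w).q12)
        - PowerSeries.coeff n ((partGram D v w).q11 * (partGram D v w).q23 * (partGram D v w).q23)
        - PowerSeries.coeff n ((partGram D v w).q22 * (partGram D v w).q13 * (partGram D v w).q13)
        - PowerSeries.coeff n ((partGram D v w).q33 * (partGram D v w).q12 * (partGram D v w).q12)
        + (4 : k) • PowerSeries.coeff n ((partGram D v w).c * (partGram D v w).c) := by
  have e1 : (2 : PowerSeries (MvPolynomial (Fin 4 × ℕ) k)) = PowerSeries.C (C 2) := by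
    rw [map_ofNat C 2, map_ofNat PowerSeries.C 2]
  have e2 : (4 : PowerSeries (MvPolynomial (Fin 4 × ℕ) k)) = PowerSeries.C (C 4) := by
    rw [map_ofNat C 4, map_ofNat PowerSeries.C 4]
  rw [Gram.rel, e1, e2]
  simp only [map_add, map_sub, PowerSeries.coeff_C_mul, C_mul']

variable {D}

theorem hasLead_rel_two_mul (h2 : IsUnit (2 : k)) (m : ℕ) :
    HasLead partKey (PowerSeries.coeff (2 * m) (partGram D v w).rel)
      (Finsupp.single (3, m) 1 + Finsupp.single (3, m) 1) := by
  have h4 : IsUnit (4 : k) := by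
    convert h2.mul h2
    norm_num
  refine hasLead_of_sub_mem (c := 4 • (1 * 1)) (by simpa using h4) ?_
  rw [coeff_rel_partGram]
  simp only [partGram, mk_X_eq_termSeries, mk_C_eq_termSeries]
  have aux : ∀ (a b c d e f : MvPolynomial (Fin 4 × ℕ) k) s,
      a + b - c - d - e + (4 : k) • f - monomial s (4 • (1 * 1)) =
        a + b - c - d - e + (4 : k) • (f - monomial s (1 * 1)) := fun a b c d e f s => by
    rw [smul_sub, smul_monomial]
    simp
    ring
  rw [aux]
  refine Submodule.add_mem _ (Submodule.sub_mem _ (Submodule.sub_mem _ (Submodule.sub_mem _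
    (Submodule.add_mem _ (coeff_mul_mul_mem_lower fun i j l h => ?_)
      (Submodule.smul_mem _ _ (coeff_mul_mul_mem_lower fun i j l h => ?_)))
      (coeff_mul_mul_mem_lower fun i j l h => ?_))
      (coeff_mul_mul_mem_lower fun i j l h => ?_))
      (coeff_mul_mul_mem_lower fun i j l h => ?_))
    (Submodule.smul_mem _ _ (coeff_mul_sub_mem_lower (by omega) fun i j h hne => ?_))
  all_goals
    refine (tripleKey_lt_iff partWt_le _ _).2 ?_
    simp [Finsupp.weight_single, partWt, partDeg]
  · rcases Nat.eq_zero_or_pos i with rfl | hi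
    · refine Or.inr ⟨by omega, ?_⟩
      zify
      rw [show (l : ℤ) = 2 * m - j by omega]
      nlinarith [consecutive_mul_nonneg (j - m) (-1), consecutive_mul_nonneg (j - m) 0]
    · exact Or.inl (by omega)
  · rcases Nat.eq_zero_or_pos i with rfl | hi
    · refine Or.inr ⟨by omega, ?_⟩
      zify
      rw [show (l : ℤ) = 2 * m - j by omega]
      nlinarith [sq_nonneg ((j : ℤ) - m)]
    · exact Or.inl (by omega)
  · refine Or.inr ⟨by omega, ?_⟩
    have h' : 0 < ((i : ℤ) - m) ^ 2 := by
      have : (i : ℤ) - m ≠ 0 := by omega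
      positivity
    zify
    rw [show (j : ℤ) = 2 * m - i by omega]
    nlinarith

theorem hasLead_rel_two_mul_add_one (hD : IsUnit (D 0)) (m : ℕ) :
    HasLead partKey (PowerSeries.coeff (2 * m + 1) (partGram D v w).rel)
      (0 + Finsupp.single (0, m) 1 + Finsupp.single (1, m + 1) 1) := by
  refine hasLead_of_sub_mem (c := D 0 * 1 * 1) (by simpa using hD) ?_
  rw [coeff_rel_partGram]
  simp only [partGram, mk_X_eq_termSeries, mk_C_eq_termSeries]
  have aux : ∀ (a b c d e f s : MvPolynomial (Fin 4 × ℕ) k),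
      a + b - c - d - e + f - s = a - s + b - c - d - e + f := fun a b c d e f s => by ring
  rw [aux]
  refine Submodule.add_mem _ (Submodule.sub_mem _ (Submodule.sub_mem _ (Submodule.sub_mem _
    (Submodule.add_mem _
      (coeff_mul_mul_sub_mem_lower (a := fun _ => 0) (by omega) fun i j l h hne => ?_)
      (Submodule.smul_mem _ _ (coeff_mul_mul_mem_lower fun i j l h => ?_)))
      (coeff_mul_mul_mem_lower fun i j l h => ?_))
      (coeff_mul_mul_mem_lower fun i j l h => ?_))
      (coeff_mul_mul_mem_lower fun i j l h => ?_))
    (Submodule.smul_mem _ _ (coeff_mul_mem_lower fun i j h => ?_))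
  all_goals
    refine (tripleKey_lt_iff partWt_le _ _).2 ?_
    simp [Finsupp.weight_single, partWt, partDeg]
  · rcases Nat.eq_zero_or_pos i with rfl | hi
    · refine Or.inr ⟨by omega, ?_⟩
      have h' : 0 < ((j : ℤ) - m) ^ 2 := by
        have : (j : ℤ) - m ≠ 0 := by omega
        positivity
      zify
      rw [show (l : ℤ) = 2 * m + 1 - j by omega]
      nlinarith
    · exact Or.inl (by omega)
  · rcases Nat.eq_zero_or_pos i with rfl | hi
    · refine Or.inr ⟨by omega, ?_⟩
      zify
      rw [show (l : ℤ) = 2 * m + 1 - j by omega]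
      nlinarith [consecutive_mul_nonneg (j - m) 0]
    · exact Or.inl (by omega)
  · refine Or.inr ⟨by omega, ?_⟩
    zify
    rw [show (j : ℤ) = 2 * m + 1 - i by omega]
    nlinarith [consecutive_mul_nonneg (i - m) 0]

/-- The minor `q11 q33 - q13²` at `t = 0`. -/
noncomputable def Gram.minor13 {A : Type*} [CommRing A] (g : Gram (PowerSeries A)) : A :=
  PowerSeries.coeff 0 g.q11 * PowerSeries.coeff 0 g.q33 - PowerSeries.coeff 0 g.q13 ^ 2

/-- The Gram minor of the first vector and the sum of the other two at `t = 0`. -/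
noncomputable def Gram.minorSum {A : Type*} [CommRing A] (g : Gram (PowerSeries A)) : A :=
  PowerSeries.coeff 0 g.q11 * (PowerSeries.coeff 0 g.q22 + 2 * PowerSeries.coeff 0 g.q23
    + PowerSeries.coeff 0 g.q33) - (PowerSeries.coeff 0 g.q12 + PowerSeries.coeff 0 g.q13) ^ 2

theorem hasLead_minor13 (hD : IsUnit (D 0)) :
    HasLead partKey (partGram D v w).minor13 (Finsupp.single (1, 0) 1) := by
  refine hasLead_of_sub_mem (c := D 0) hD ?_
  have h : (partGram D v w).minor13 - monomial (Finsupp.single (1, 0) 1) (D 0)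
      = monomial 0 (- v 0 ^ 2) := by
    rw [← C_apply, ← C_mul_X_eq_monomial]
    simp [Gram.minor13, partGram]
  rw [h]
  refine monomial_mem_lowerSubmodule ((tripleKey_lt_iff partWt_le _ _).2 (Or.inl ?_)) _
  simp [Finsupp.weight_single, partDeg]

theorem hasLead_minorSum (h2 : IsUnit (2 : k)) (hD : IsUnit (D 0)) :
    HasLead partKey (partGram D v w).minorSum (Finsupp.single (2, 0) 1) := by
  refine hasLead_of_sub_mem (c := 2 * D 0) (h2.mul hD) ?_
  have h : (partGram D v w).minorSum - monomial (Finsupp.single (2, 0) 1) (2 * D 0)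
      = monomial 0 (- (w 0 + v 0) ^ 2) + monomial (Finsupp.single (0, 0) 1) (D 0)
        + monomial (Finsupp.single (1, 0) 1) (D 0) := by
    rw [← C_apply, ← C_mul_X_eq_monomial, ← C_mul_X_eq_monomial, ← C_mul_X_eq_monomial]
    simp only [Gram.minorSum, partGram, PowerSeries.coeff_mk, map_mul, map_ofNat C 2]
    simp
    ring
  rw [h]
  refine Submodule.add_mem _ (Submodule.add_mem _ ?_ ?_) ?_ <;>
    refine monomial_mem_lowerSubmodule ((tripleKey_lt_iff partWt_le _ _).2 ?_) _ <;>
    simp [Finsupp.weight_single, partDeg, partWt]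

variable (D)

/-- The relations together with two minors. -/
noncomputable def partSeq : Fin 2 ⊕ ℕ × Fin 2 → MvPolynomial (Fin 4 × ℕ) k :=
  Sum.elim ![(partGram D v w).minor13, (partGram D v w).minorSum]
    fun p => PowerSeries.coeff (2 * p.1 + p.2) (partGram D v w).rel

/-- The leading exponents of `partSeq`. -/
noncomputable def partLead : Fin 2 ⊕ ℕ × Fin 2 → Fin 4 × ℕ →₀ ℕ :=
  Sum.elim ![Finsupp.single (1, 0) 1, Finsupp.single (2, 0) 1] fun p =>
    ![Finsupp.single (3, p.1) 1 + Finsupp.single (3, p.1) 1,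
      0 + Finsupp.single (0, p.1) 1 + Finsupp.single (1, p.1 + 1) 1] p.2

/-- The index of the element of `partSeq` whose leading exponent involves a given variable. -/
def partOwner : Fin 4 × ℕ → Fin 2 ⊕ ℕ × Fin 2
  | (0, m) => .inr (m, 1)
  | (1, 0) => .inl 0
  | (1, m + 1) => .inr (m, 1)
  | (2, _) => .inl 1
  | (3, m) => .inr (m, 0)

theorem partLead_owner (i : Fin 2 ⊕ ℕ × Fin 2) (s : Fin 4 × ℕ) (h : partLead i s ≠ 0) :
    partOwner s = i := by
  classical
  rcases i with i | ⟨m, i⟩ <;> fin_cases i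
  all_goals
    by_contra hc
    apply h
    simp [partLead]
  all_goals try refine ⟨?_, ?_⟩
  all_goals
    refine Finsupp.single_eq_of_ne ?_
    rintro rfl
    exact hc rfl

theorem partLead_ne_zero (i : Fin 2 ⊕ ℕ × Fin 2) : partLead i ≠ 0 := by
  intro h
  have h' := congrArg (Finsupp.weight partDeg) h
  rcases i with i | ⟨m, i⟩ <;> fin_cases i <;>
    simp [partLead, partDeg, Finsupp.weight_single] at h'

theorem partSeq_image_range_inr : partSeq D v w '' Set.range Sum.inr =
    Set.range fun n => PowerSeries.coeff n (partGram D v w).rel := by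
  ext x
  constructor
  · rintro ⟨_, ⟨p, rfl⟩, rfl⟩
    exact ⟨_, rfl⟩
  · rintro ⟨n, rfl⟩
    refine ⟨_, ⟨(n / 2, ⟨n % 2, Nat.mod_lt _ (by norm_num)⟩), rfl⟩, ?_⟩
    simp only [partSeq, Sum.elim_inr]
    rw [Nat.div_add_mod]

/-- The ideal of coefficients of the relation of `partGram`. -/
noncomputable def partIdeal : Ideal (MvPolynomial (Fin 4 × ℕ) k) :=
  Ideal.span (Set.range fun n => PowerSeries.coeff n (partGram D v w).rel)

variable {D} {v w}

theorem partSeq_hasLead (h2 : IsUnit (2 : k)) (hD : IsUnit (D 0)) (i : Fin 2 ⊕ ℕ × Fin 2) :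
    HasLead partKey (partSeq D v w i) (partLead i) := by
  rcases i with i | ⟨m, i⟩ <;> fin_cases i
  · exact hasLead_minor13 v w hD
  · exact hasLead_minorSum v w h2 hD
  · exact hasLead_rel_two_mul v w h2 m
  · exact hasLead_rel_two_mul_add_one v w hD m

theorem mem_partIdeal_of_minor13_mul_mem (h2 : IsUnit (2 : k)) (hD : IsUnit (D 0))
    {a : MvPolynomial (Fin 4 × ℕ) k} (h : (partGram D v w).minor13 * a ∈ partIdeal D v w) :
    a ∈ partIdeal D v w := by
  rw [partIdeal, ← partSeq_image_range_inr] at *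
  exact mem_span_of_mul_mem partKey_add_lt (partSeq_hasLead h2 hD)
    (pairwise_disjoint_support_of_owner partOwner partLead_owner) partLead_ne_zero
    (i := .inl 0) (by simp) h

theorem mem_of_minorSum_mul_mem (h2 : IsUnit (2 : k)) (hD : IsUnit (D 0))
    {a : MvPolynomial (Fin 4 × ℕ) k}
    (h : (partGram D v w).minorSum * a ∈
      Ideal.span {(partGram D v w).minor13} ⊔ partIdeal D v w) :
    a ∈ Ideal.span {(partGram D v w).minor13} ⊔ partIdeal D v w := by
  have e : Ideal.span {(partGram D v w).minor13} ⊔ partIdeal D v w =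
      Ideal.span (partSeq D v w '' insert (.inl 0) (Set.range Sum.inr)) := by
    rw [Set.image_insert_eq, partSeq_image_range_inr, Ideal.span_insert]
    rfl
  rw [e] at h ⊢
  exact mem_span_of_mul_mem partKey_add_lt (partSeq_hasLead h2 hD)
    (pairwise_disjoint_support_of_owner partOwner partLead_owner) partLead_ne_zero
    (i := .inl 1) (by simp) h

section Regular

variable {T : Type*} [CommRing T] {I : Ideal T} {y z : T}

theorem mem_of_pow_mul_mem (hy : ∀ a, y * a ∈ I → a ∈ I) (n : ℕ) {a : T} (h : y ^ n * a ∈ I) :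
    a ∈ I := by
  induction n generalizing a with
  | zero => simpa using h
  | succ n ih => exact hy a (ih (by rwa [← mul_assoc, ← pow_succ]))

theorem mem_sup_of_mul_mem_sup (hy : ∀ a, y * a ∈ I → a ∈ I)
    (hz : ∀ a, z * a ∈ Ideal.span {y} ⊔ I → a ∈ Ideal.span {y} ⊔ I) (n : ℕ) {a : T}
    (h : z * a ∈ Ideal.span {y ^ n} ⊔ I) : a ∈ Ideal.span {y ^ n} ⊔ I := by
  induction n generalizing a with
  | zero => simp
  | succ n ih =>
    have ha : a ∈ Ideal.span {y} ⊔ I := hz a <| by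
      refine sup_le_sup_right (Ideal.span_singleton_le_span_singleton.2 ?_) I h
      exact dvd_pow_self y n.succ_ne_zero
    obtain ⟨b, i, hi, rfl⟩ := Ideal.mem_span_singleton_sup.1 ha
    obtain ⟨c, j, hj, hc⟩ := Ideal.mem_span_singleton_sup.1 h
    have h1 : z * b ∈ Ideal.span {y ^ n} ⊔ I := by
      refine Ideal.mem_span_singleton_sup.2 ⟨c, z * b - c * y ^ n, hy _ ?_, by ring⟩
      have : y * (z * b - c * y ^ n) = j - z * i := by
        linear_combination -hc
      rw [this]
      exact sub_mem hj (I.mul_mem_left _ hi)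
    obtain ⟨d, l, hl, rfl⟩ := Ideal.mem_span_singleton_sup.1 (ih h1)
    exact Ideal.mem_span_singleton_sup.2
      ⟨d, l * y + i, add_mem (I.mul_mem_right _ hl) hi, by ring⟩

theorem mem_sup_of_pow_mul_mem_sup (hy : ∀ a, y * a ∈ I → a ∈ I)
    (hz : ∀ a, z * a ∈ Ideal.span {y} ⊔ I → a ∈ Ideal.span {y} ⊔ I) (m n : ℕ) {a : T}
    (h : z ^ m * a ∈ Ideal.span {y ^ n} ⊔ I) : a ∈ Ideal.span {y ^ n} ⊔ I :=
  mem_of_pow_mul_mem (fun _ => mem_sup_of_mul_mem_sup hy hz n) m h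

end Regular

/-- The coefficient ring of `q11`, `q13`, `q12` with `q11(0)` inverted. -/
abbrev PartBase : Type :=
  Localization.Away (X (0, 0) : MvPolynomial (Fin 3 × ℕ) ℂ)

/-- The localization map inverting `q11(0)`. -/
noncomputable def invertQ11 : MvPolynomial GramVar ℂ →+* MvPolynomial (Fin 4 × ℕ) PartBase :=
  (MvPolynomial.map (algebraMap (MvPolynomial (Fin 3 × ℕ) ℂ) PartBase)).comp
    (sumAlgEquiv ℂ (Fin 4 × ℕ) (Fin 3 × ℕ)).toRingHom

theorem exists_pow_mul_mem_of_invertQ11_mem {J : Ideal (MvPolynomial GramVar ℂ)}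
    {a : MvPolynomial GramVar ℂ} (h : invertQ11 a ∈ J.map invertQ11) :
    ∃ N : ℕ, X (.inr (0, 0)) ^ N * a ∈ J := by
  let _ : Algebra (MvPolynomial (Fin 4 × ℕ) (MvPolynomial (Fin 3 × ℕ) ℂ))
      (MvPolynomial (Fin 4 × ℕ) PartBase) := algebraMvPolynomial
  let e := sumAlgEquiv ℂ (Fin 4 × ℕ) (Fin 3 × ℕ)
  have h' : algebraMap _ (MvPolynomial (Fin 4 × ℕ) PartBase) (e a) ∈
      (J.map e.toRingHom).map (algebraMap _ (MvPolynomial (Fin 4 × ℕ) PartBase)) := by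
    rw [Ideal.map_map]
    exact h
  obtain ⟨_, ⟨_, ⟨N, rfl⟩, rfl⟩, hm⟩ := (IsLocalization.algebraMap_mem_map_algebraMap_iff
    ((Submonoid.powers (X (0, 0) : MvPolynomial (Fin 3 × ℕ) ℂ)).map
      (C (σ := Fin 4 × ℕ))) _ _ _).1 h'
  refine ⟨N, ?_⟩
  have h2 : e (X (.inr (0, 0)) ^ N * a) ∈ J.map e.toRingHom := by
    convert hm using 1
    simp [e]
  obtain ⟨x, hx, hxe⟩ := (Ideal.mem_map_iff_of_surjective e.toRingHom e.surjective).1 h2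
  rwa [← e.injective hxe]

/-- A coefficient of `q11`, `q13` or `q12` in `PartBase`. -/
noncomputable def partVar (i : Fin 3) (n : ℕ) : PartBase :=
  algebraMap (MvPolynomial (Fin 3 × ℕ) ℂ) PartBase (X (i, n))

theorem invertQ11_inl (p : Fin 4 × ℕ) : invertQ11 (X (.inl p)) = X p := by
  simp [invertQ11]

theorem invertQ11_inr (p : Fin 3 × ℕ) : invertQ11 (X (.inr p)) = C (partVar p.1 p.2) := by
  simp [invertQ11, partVar]

/-- The image of `genGram` under `invertQ11`. -/
noncomputable def locGram : Gram (PowerSeries (MvPolynomial (Fin 4 × ℕ) PartBase)) :=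
  partGram (partVar 0) (partVar 1) (partVar 2)

theorem genGram_map_invertQ11 : genGram.map (PowerSeries.map invertQ11) = locGram := by
  rw [locGram, partGram, Gram.map]
  congr 1 <;> ext1 n <;> simp [genGram, invertQ11_inl, invertQ11_inr]

theorem Gram.minor13_map {A B : Type*} [CommRing A] [CommRing B] (f : A →+* B)
    (g : Gram (PowerSeries A)) : (g.map (PowerSeries.map f)).minor13 = f g.minor13 := by
  simp [Gram.minor13, Gram.map]

theorem Gram.minorSum_map {A B : Type*} [CommRing A] [CommRing B] (f : A →+* B)
    (g : Gram (PowerSeries A)) : (g.map (PowerSeries.map f)).minorSum = f g.minorSum := by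
  have h2 : f 2 = 2 := map_ofNat f 2
  simp [Gram.minorSum, Gram.map, h2]

theorem relIdeal_map_invertQ11 : relIdeal.map invertQ11 =
    partIdeal (partVar 0) (partVar 1) (partVar 2) := by
  rw [relIdeal, Ideal.map_span, partIdeal, ← Set.range_comp]
  congr 2
  ext1 k
  change _ = PowerSeries.coeff k locGram.rel
  rw [← genGram_map_invertQ11, Gram.rel_map]
  simp

theorem isUnit_two_partBase : IsUnit (2 : PartBase) := by
  rw [← map_ofNat (algebraMap ℂ PartBase) 2]
  exact (IsUnit.mk0 (2 : ℂ) two_ne_zero).map _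

theorem isUnit_q11_partBase :
    IsUnit (partVar 0 0) :=
  IsLocalization.Away.algebraMap_isUnit _

theorem isUnit_invertQ11_q11 : IsUnit (invertQ11 (X (.inr (0, 0)))) := by
  rw [invertQ11_inr]
  exact isUnit_q11_partBase.map C

theorem mem_of_invertQ11_minor13_mul_mem (a : MvPolynomial (Fin 4 × ℕ) PartBase)
    (h : invertQ11 genGram.minor13 * a ∈ relIdeal.map invertQ11) :
    a ∈ relIdeal.map invertQ11 := by
  rw [relIdeal_map_invertQ11] at *
  rw [← Gram.minor13_map, genGram_map_invertQ11] at h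
  exact mem_partIdeal_of_minor13_mul_mem isUnit_two_partBase isUnit_q11_partBase h

theorem mem_of_invertQ11_minorSum_mul_mem (a : MvPolynomial (Fin 4 × ℕ) PartBase)
    (h : invertQ11 genGram.minorSum * a ∈
      Ideal.span {invertQ11 genGram.minor13} ⊔ relIdeal.map invertQ11) :
    a ∈ Ideal.span {invertQ11 genGram.minor13} ⊔ relIdeal.map invertQ11 := by
  rw [relIdeal_map_invertQ11, ← Gram.minor13_map, genGram_map_invertQ11] at *
  rw [← Gram.minorSum_map, genGram_map_invertQ11] at h
  exact mem_of_minorSum_mul_mem isUnit_two_partBase isUnit_q11_partBase h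

theorem exists_q11_pow_mul_mem {a : MvPolynomial GramVar ℂ} {n : ℕ}
    (h : (X (.inr (0, 0)) * genGram.minor13) ^ n * a ∈ relIdeal) :
    ∃ N : ℕ, X (.inr (0, 0)) ^ N * a ∈ relIdeal := by
  apply exists_pow_mul_mem_of_invertQ11_mem
  have h1 := Ideal.mem_map_of_mem invertQ11 h
  rw [map_mul, map_pow, map_mul, mul_pow, mul_assoc] at h1
  exact mem_of_pow_mul_mem mem_of_invertQ11_minor13_mul_mem n
    ((Ideal.unit_mul_mem_iff_mem _ (isUnit_invertQ11_q11.pow n)).1 h1)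

theorem exists_q11_pow_mul_sub_mem {a b : MvPolynomial GramVar ℂ} {m n : ℕ}
    (h : (X (.inr (0, 0)) * genGram.minorSum) ^ m * a
      - (X (.inr (0, 0)) * genGram.minor13) ^ n * b ∈ relIdeal) :
    ∃ (N : ℕ) (a' : MvPolynomial GramVar ℂ),
      X (.inr (0, 0)) ^ N * a - genGram.minor13 ^ n * a' ∈ relIdeal := by
  have key : invertQ11 a ∈ (Ideal.span {genGram.minor13 ^ n} ⊔ relIdeal).map invertQ11 := by
    have h1 := Ideal.mem_map_of_mem invertQ11 h
    rw [Ideal.map_sup, Ideal.map_span, Set.image_singleton, map_pow]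
    refine mem_sup_of_pow_mul_mem_sup mem_of_invertQ11_minor13_mul_mem
      mem_of_invertQ11_minorSum_mul_mem m n
      ((Ideal.unit_mul_mem_iff_mem _ (isUnit_invertQ11_q11.pow m)).1 ?_)
    refine Ideal.mem_span_singleton_sup.2 ⟨invertQ11 (X (.inr (0, 0)) ^ n * b), _, h1, ?_⟩
    simp only [map_mul, map_sub, map_pow]
    ring
  obtain ⟨N, hN⟩ := exists_pow_mul_mem_of_invertQ11_mem key
  obtain ⟨a', i, hi, h⟩ := Ideal.mem_span_singleton_sup.1 hN
  refine ⟨N, a', ?_⟩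
  rw [← h]
  convert hi using 1
  ring

/-- The arc space ring of three copies of the adjoint representation. -/
abbrev ArcRing : Type := MvPolynomial ((Fin 3 × Fin 3) × ℕ) ℂ

theorem Derivation.iterate_eq_zero_of_commutator {A : Type*} [CommRing A] [Algebra ℂ A]
    {Δ : ℕ → Derivation ℂ A A} {D : Derivation ℂ A A}
    (h : ∀ r a, Δ r (D a) = D (Δ r a) + (r : ℂ) • Δ (r - 1) a) {a : A} (ha : ∀ r, Δ r a = 0)
    (k r : ℕ) : Δ r (D^[k] a) = 0 := by
  induction k generalizing r with
  | zero => exact ha r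
  | succ k ih => simp [Function.iterate_succ_apply', h, ih]

theorem arcDer_arcD (m : ℕ) (ξ : Fin 3) (r : ℕ) (p : MvPolynomial ((Fin m × Fin 3) × ℕ) ℂ) :
    arcDer m ξ r (arcD m p) = arcD m (arcDer m ξ r p) + (r : ℂ) • arcDer m ξ (r - 1) p := by
  have key : ⁅arcDer m ξ r, arcD m⁆ = (r : ℂ) • arcDer m ξ (r - 1) := by
    refine MvPolynomial.derivation_ext fun v => ?_
    obtain ⟨⟨i, η⟩, k⟩ := v
    rw [Derivation.commutator_apply, Derivation.smul_apply]
    have hD (k : ℕ) : arcD m (∑ θ : Fin 3, C (slBr ξ η θ) * X ((i, θ), k))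
        = ∑ θ : Fin 3, C (slBr ξ η θ) * X ((i, θ), k + 1) := by
      simp [arcD, Derivation.leibniz, mkDerivation_X]
    have hΔ (r k : ℕ) : arcDer m ξ r (X ((i, η), k)) =
        (k.descFactorial r : ℂ) • ∑ θ : Fin 3, C (slBr ξ η θ) * X ((i, θ), k - r) := by
      simp [arcDer, mkDerivation_X]
    rw [show arcD m (X ((i, η), k)) = X ((i, η), k + 1) by simp [arcD, mkDerivation_X], hΔ, hΔ, hΔ,
      Derivation.map_smul, hD, smul_smul]
    cases r with
    | zero => simp
    | succ r =>
      rw [Nat.succ_descFactorial_succ, Nat.add_sub_add_right, Nat.add_sub_cancel]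
      rcases le_or_gt k r with hk | hk
      · rw [Nat.descFactorial_of_lt (show k < r + 1 by omega), Nat.cast_zero, zero_smul, sub_zero]
        rcases hk.eq_or_lt with rfl | hk
        · push_cast
          rfl
        · simp [Nat.descFactorial_of_lt hk]
      · rw [show k - (r + 1) + 1 = k - r by omega, ← sub_smul, Nat.descFactorial_succ]
        congr 1
        push_cast [hk.le]
        ring
  have := congrArg (fun d => d p) key
  simp only [Derivation.commutator_apply, Derivation.smul_apply] at this
  rw [← this]
  ring

theorem arcDer_arcQ (ξ : Fin 3) (r : ℕ) (i j : Fin 3) : arcDer 3 ξ r (arcQ 3 i j) = 0 := by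
  have h2 : arcDer 3 ξ r (2 : ArcRing) = 0 := (arcDer 3 ξ r).map_natCast 2
  cases r with
  | succ r =>
    simp only [arcQ, map_add, Derivation.leibniz, h2]
    simp [arcDer, mkDerivation_X]
  | zero =>
    have hC : (C 2 : ArcRing) = 2 := map_ofNat C 2
    simp only [arcQ, map_add, Derivation.leibniz, h2]
    fin_cases ξ <;> simp [arcDer, mkDerivation_X, slBr, Fin.sum_univ_three, hC] <;> ring

theorem arcDer_arcC (ξ : Fin 3) (r : ℕ) : arcDer 3 ξ r arcC = 0 := by
  rw [arcC, Matrix.det_fin_three]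
  cases r with
  | succ r => simp [arcDer, Derivation.leibniz, mkDerivation_X]
  | zero =>
    simp only [map_add, map_sub, Derivation.leibniz]
    fin_cases ξ <;> simp [arcDer, mkDerivation_X, slBr, Fin.sum_univ_three] <;> ring

/-- The algebra generated by all derivatives of the `q_{ij}` and of `c_{123}`. -/
noncomputable def jetInvariants : Subalgebra ℂ ArcRing :=
  Algebra.adjoin ℂ
    ({w | ∃ (k : ℕ) (i j : Fin 3), w = (⇑(arcD 3))^[k] (arcQ 3 i j)} ∪
      {w | ∃ k : ℕ, w = (⇑(arcD 3))^[k] arcC})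

theorem arcDer_eq_zero_of_mem_jetInvariants {p : ArcRing} (hp : p ∈ jetInvariants) (ξ : Fin 3)
    (r : ℕ) : arcDer 3 ξ r p = 0 := by
  induction hp using Algebra.adjoin_induction with
  | mem x hx =>
    obtain ⟨k, i, j, rfl⟩ | ⟨k, rfl⟩ := hx
    · exact Derivation.iterate_eq_zero_of_commutator (arcDer_arcD 3 ξ)
        (fun r => arcDer_arcQ ξ r i j) k r
    · exact Derivation.iterate_eq_zero_of_commutator (arcDer_arcD 3 ξ)
        (fun r => arcDer_arcC ξ r) k r
  | algebraMap a => exact Derivation.map_algebraMap _ a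
  | add x y _ _ hx hy => rw [map_add, hx, hy, add_zero]
  | mul x y _ _ hx hy => rw [Derivation.leibniz, hx, hy, smul_zero, smul_zero, add_zero]

section GramOf

variable {A B : Type*} [CommRing A] [CommRing B]

/-- The bilinear form `q` on rows. -/
def rowForm (u v : Fin 3 → A) : A := u 0 * v 0 + 2 * u 1 * v 2 + 2 * v 1 * u 2

/-- The Gram data of the three rows of a matrix. -/
def gramOf (V : Matrix (Fin 3) (Fin 3) A) : Gram A where
  q11 := rowForm (V 0) (V 0)
  q22 := rowForm (V 1) (V 1)
  q33 := rowForm (V 2) (V 2)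
  q23 := rowForm (V 1) (V 2)
  q13 := rowForm (V 0) (V 2)
  q12 := rowForm (V 0) (V 1)
  c := V.det

theorem rowForm_map (f : A →+* B) (V : Matrix (Fin 3) (Fin 3) A) (i j : Fin 3) :
    rowForm (V.map f i) (V.map f j) = f (rowForm (V i) (V j)) := by
  have h2 : f 2 = 2 := map_ofNat f 2
  simp [rowForm, h2]

theorem gramOf_map (f : A →+* B) (V : Matrix (Fin 3) (Fin 3) A) :
    gramOf (V.map f) = (gramOf V).map f := by
  simp only [gramOf, Gram.map, rowForm_map]
  congr 1
  exact (RingHom.map_det f V).symm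

theorem Gram.map_map {A B C : Type*} (f : A → B) (h : B → C) (g : Gram A) :
    (g.map f).map h = g.map (h ∘ f) := rfl

/-- Gram data after exchanging the second and third vector. -/
def Gram.swap (g : Gram A) : Gram A := ⟨g.q11, g.q33, g.q22, g.q23, g.q12, g.q13, -g.c⟩

/-- Gram data after adding the third vector to the second. -/
def Gram.shear (g : Gram A) : Gram A :=
  ⟨g.q11, g.q22 + 2 * g.q23 + g.q33, g.q33, g.q23 + g.q33, g.q13, g.q12 + g.q13, g.c⟩

/-- Gram data after adding the second vector to the first. -/
def Gram.shearFirst (g : Gram A) : Gram A :=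
  ⟨g.q11 + 2 * g.q12 + g.q22, g.q22, g.q33, g.q23, g.q13 + g.q23, g.q12 + g.q22, g.c⟩

theorem Gram.swap_map (f : A →+* B) (g : Gram A) : (g.map f).swap = g.swap.map f := by
  simp [Gram.swap, Gram.map]

theorem Gram.swap_swap (g : Gram A) : g.swap.swap = g := by simp [Gram.swap]

theorem Gram.rel_swap (g : Gram A) : g.swap.rel = g.rel := by
  simp only [Gram.rel, Gram.swap]
  ring

theorem Gram.shear_map (f : A →+* B) (g : Gram A) : (g.map f).shear = g.shear.map f := by
  have h2 : f 2 = 2 := map_ofNat f 2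
  simp [Gram.shear, Gram.map, h2]

theorem Gram.shearFirst_map (f : A →+* B) (g : Gram A) :
    (g.map f).shearFirst = g.shearFirst.map f := by
  have h2 : f 2 = 2 := map_ofNat f 2
  simp [Gram.shearFirst, Gram.map, h2]

/-- An integer matrix over an arbitrary ring. -/
def intMat (A : Type*) [CommRing A] (L : Matrix (Fin 3) (Fin 3) ℤ) : Matrix (Fin 3) (Fin 3) A :=
  L.map (Int.castRingHom A)

theorem intMat_map (f : A →+* B) (L : Matrix (Fin 3) (Fin 3) ℤ) :
    (intMat A L).map f = intMat B L := by
  ext i j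
  simp [intMat]

theorem intMat_mul (L M : Matrix (Fin 3) (Fin 3) ℤ) : intMat A (L * M) = intMat A L * intMat A M :=
  Matrix.map_mul

theorem intMat_one : intMat A 1 = 1 := by
  simp [intMat]

/-- The matrix exchanging the last two rows. -/
def swapMat : Matrix (Fin 3) (Fin 3) ℤ := !![1, 0, 0; 0, 0, 1; 0, 1, 0]

/-- The matrix adding the third row to the second one. -/
def shearMat : Matrix (Fin 3) (Fin 3) ℤ := !![1, 0, 0; 0, 1, 1; 0, 0, 1]

/-- The matrix adding the second row to the first one. -/
def shearFirstMat : Matrix (Fin 3) (Fin 3) ℤ := !![1, 1, 0; 0, 1, 0; 0, 0, 1]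

theorem gramOf_swapMat_mul (V : Matrix (Fin 3) (Fin 3) A) :
    gramOf (intMat A swapMat * V) = (gramOf V).swap := by
  simp only [gramOf, Gram.swap, rowForm, Matrix.det_fin_three, Gram.mk.injEq]
  simp [Matrix.mul_apply, Fin.sum_univ_three, intMat, swapMat]
  ring_nf
  simp

theorem gramOf_shearMat_mul (V : Matrix (Fin 3) (Fin 3) A) :
    gramOf (intMat A shearMat * V) = (gramOf V).shear := by
  simp only [gramOf, Gram.shear, rowForm, Matrix.det_fin_three, Gram.mk.injEq]
  simp [Matrix.mul_apply, Fin.sum_univ_three, intMat, shearMat]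
  ring_nf
  simp

theorem gramOf_shearFirstMat_mul (V : Matrix (Fin 3) (Fin 3) A) :
    gramOf (intMat A shearFirstMat * V) = (gramOf V).shearFirst := by
  simp only [gramOf, Gram.shearFirst, rowForm, Matrix.det_fin_three, Gram.mk.injEq]
  simp [Matrix.mul_apply, Fin.sum_univ_three, intMat, shearFirstMat]
  ring_nf
  simp

end GramOf

section Classify

variable {A B : Type*} [CommRing A] [CommRing B]

/-- The ring homomorphism specializing the generic Gram data to given ones. -/
noncomputable def classify (κ : ℂ →+* A) (g : Gram (PowerSeries A)) :
    MvPolynomial GramVar ℂ →+* A :=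
  eval₂Hom κ (Sum.elim
    (fun v => PowerSeries.coeff v.2 ((![g.q22, g.q33, g.q23, g.c] : Fin 4 → _) v.1))
    (fun v => PowerSeries.coeff v.2 ((![g.q11, g.q13, g.q12] : Fin 3 → _) v.1)))

theorem genGram_map_classify (κ : ℂ →+* A) (g : Gram (PowerSeries A)) :
    genGram.map (PowerSeries.map (classify κ g)) = g := by
  obtain ⟨_, _, _, _, _, _, _⟩ := g
  simp only [Gram.map, Gram.mk.injEq]
  refine ⟨?_, ?_, ?_, ?_, ?_, ?_, ?_⟩ <;> ext n <;> simp [genGram, classify]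

theorem ringHom_eq_classify (f : MvPolynomial GramVar ℂ →+* A) :
    f = classify (f.comp C) (genGram.map (PowerSeries.map f)) := by
  refine MvPolynomial.ringHom_ext (by simp [classify]) fun v => ?_
  obtain ⟨i, n⟩ | ⟨i, n⟩ := v <;> fin_cases i <;> simp [classify, genGram, Gram.map]

theorem comp_classify (f : A →+* B) (κ : ℂ →+* A) (g : Gram (PowerSeries A)) :
    f.comp (classify κ g) = classify (f.comp κ) (g.map (PowerSeries.map f)) := by
  rw [ringHom_eq_classify (f.comp (classify κ g))]
  congr 1
  · ext x
    simp [classify]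
  · conv_rhs => rw [← genGram_map_classify κ g, Gram.map_map]
    congr 1

theorem classify_comp_C (κ : ℂ →+* A) (g : Gram (PowerSeries A)) : (classify κ g).comp C = κ := by
  ext x
  simp [classify]

end Classify

section Jets

/-- The power series whose coefficients are compatible with the jet derivation. -/
noncomputable def arcSeries : Subring (PowerSeries ArcRing) where
  carrier := {f | ∀ n, arcD 3 (PowerSeries.coeff n f) = (n + 1) * PowerSeries.coeff (n + 1) f}
  zero_mem' n := by simp
  one_mem' n := by cases n <;> simp [PowerSeries.coeff_one]
  add_mem' hf hg n := by
    simp only [map_add, hf n, hg n]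
    ring
  neg_mem' hf n := by
    simp only [map_neg, hf n]
    ring
  mul_mem' {f g} hf hg n := by
    have h (f : PowerSeries ArcRing) (n : ℕ) : ((n : ArcRing) + 1) * PowerSeries.coeff (n + 1) f
        = PowerSeries.coeff n (PowerSeries.derivative ArcRing f) := by
      rw [PowerSeries.coeff_derivative, mul_comm]
    simp only [Set.mem_ofPred_eq, h] at hf hg ⊢
    rw [Derivation.leibniz, map_add, smul_eq_mul, smul_eq_mul, mul_comm g]
    simp only [PowerSeries.coeff_mul, map_sum, Derivation.leibniz, hf, hg, smul_eq_mul,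
      Finset.sum_add_distrib]
    congr 1
    exact Finset.sum_congr rfl fun x _ => mul_comm _ _

theorem coeff_mem_jetInvariants {f : PowerSeries ArcRing} (hf : f ∈ arcSeries)
    (h : ∀ k, (arcD 3)^[k] (PowerSeries.coeff 0 f) ∈ jetInvariants) (n : ℕ) :
    PowerSeries.coeff n f ∈ jetInvariants := by
  have key : (arcD 3)^[n] (PowerSeries.coeff 0 f) =
      (n.factorial : ArcRing) * PowerSeries.coeff n f := by
    induction n with
    | zero => simp
    | succ n ih =>
      have h0 : arcD 3 (n.factorial : ArcRing) = 0 := (arcD 3).map_natCast _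
      rw [Function.iterate_succ_apply', ih, Derivation.leibniz, hf n, h0, Nat.factorial_succ]
      push_cast
      simp only [smul_eq_mul]
      ring
  have : PowerSeries.coeff n f =
      ((n.factorial : ℂ)⁻¹) • (arcD 3)^[n] (PowerSeries.coeff 0 f) := by
    have h0 : (n.factorial : ℂ) ≠ 0 := by exact_mod_cast n.factorial_ne_zero
    rw [key, ← nsmul_eq_mul, ← Nat.cast_smul_eq_nsmul ℂ, smul_smul, inv_mul_cancel₀ h0, one_smul]
  rw [this]
  exact jetInvariants.smul_mem (h n) _

/-- The matrix of generic arcs. -/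
noncomputable def genArc : Matrix (Fin 3) (Fin 3) (PowerSeries ArcRing) :=
  Matrix.of fun i η => PowerSeries.mk fun k => ((k.factorial : ℂ)⁻¹) • X ((i, η), k)

theorem genArc_mem (i η : Fin 3) : genArc i η ∈ arcSeries := by
  intro n
  simp only [genArc, Matrix.of_apply, PowerSeries.coeff_mk, Derivation.map_smul]
  rw [show arcD 3 (X ((i, η), n)) = X ((i, η), n + 1) by simp [arcD, mkDerivation_X]]
  have h0 : (n.factorial : ℂ) ≠ 0 := by exact_mod_cast n.factorial_ne_zero
  have h1 : (n + 1 : ℂ) ≠ 0 := by exact_mod_cast n.succ_ne_zero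
  rw [show (n + 1 : ArcRing) = ((n + 1 : ℕ) : ArcRing) by push_cast; rfl, ← nsmul_eq_mul,
    ← Nat.cast_smul_eq_nsmul ℂ, smul_smul, Nat.factorial_succ]
  congr 1
  push_cast
  field_simp

theorem coeff_rowForm_genArc_mem (i j : Fin 3) (n : ℕ) :
    PowerSeries.coeff n (rowForm (genArc i) (genArc j)) ∈ jetInvariants := by
  refine coeff_mem_jetInvariants ?_ (fun k => ?_) n
  · have h2 : (2 : PowerSeries ArcRing) ∈ arcSeries := ofNat_mem arcSeries 2
    have h := genArc_mem
    exact add_mem (add_mem (mul_mem (h _ _) (h _ _)) (mul_mem (mul_mem h2 (h _ _)) (h _ _)))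
      (mul_mem (mul_mem h2 (h _ _)) (h _ _))
  · refine Algebra.subset_adjoin (Or.inl ⟨k, i, j, ?_⟩)
    congr 1
    have h2 : PowerSeries.constantCoeff (2 : PowerSeries ArcRing) = 2 := map_ofNat _ 2
    simp [rowForm, arcQ, genArc, h2]

theorem coeff_det_genArc_mem (n : ℕ) : PowerSeries.coeff n genArc.det ∈ jetInvariants := by
  refine coeff_mem_jetInvariants ?_ (fun k => ?_) n
  · have h := genArc_mem
    rw [Matrix.det_fin_three]
    refine sub_mem (add_mem (add_mem (sub_mem (sub_mem ?_ ?_) ?_) ?_) ?_) ?_ <;>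
      exact mul_mem (mul_mem (h _ _) (h _ _)) (h _ _)
  · refine Algebra.subset_adjoin (Or.inr ⟨k, ?_⟩)
    congr 1
    simp [Matrix.det_fin_three, arcC, genArc]

/-- The specialization of the generic Gram data to that of the generic arcs. -/
noncomputable def arcClassify : MvPolynomial GramVar ℂ →+* ArcRing := classify C (gramOf genArc)

theorem arcClassify_mem (a : MvPolynomial GramVar ℂ) : arcClassify a ∈ jetInvariants := by
  induction a using MvPolynomial.induction_on with
  | C a => simpa [arcClassify, classify] using jetInvariants.algebraMap_mem a
  | add p q hp hq => simpa using add_mem hp hq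
  | mul_X p v hp =>
    rw [map_mul]
    refine mul_mem hp ?_
    obtain ⟨i, n⟩ | ⟨i, n⟩ := v <;> fin_cases i <;>
      simp [arcClassify, classify, gramOf, coeff_rowForm_genArc_mem, coeff_det_genArc_mem]

end Jets

section Ev

variable {A B : Type*} [CommRing A] [CommRing B]

/-- Evaluation of the arc space ring at a triple of arcs. -/
noncomputable def arcEval (κ : ℂ →+* A) (V : Matrix (Fin 3) (Fin 3) (PowerSeries A)) :
    ArcRing →+* A :=
  eval₂Hom κ fun v => (v.2.factorial : A) * PowerSeries.coeff v.2 (V v.1.1 v.1.2)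

theorem comp_arcEval (f : A →+* B) (κ : ℂ →+* A) (V : Matrix (Fin 3) (Fin 3) (PowerSeries A)) :
    f.comp (arcEval κ V) = arcEval (f.comp κ) (V.map (PowerSeries.map f)) := by
  refine MvPolynomial.ringHom_ext (fun x => by simp [arcEval]) fun v => by simp [arcEval]

theorem arcEval_genArc (f : ArcRing →+* A) :
    arcEval (f.comp C) (genArc.map (PowerSeries.map f)) = f := by
  refine MvPolynomial.ringHom_ext (by simp [arcEval]) fun v => ?_
  have h0 : (v.2.factorial : ℂ) ≠ 0 := by exact_mod_cast v.2.factorial_ne_zero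
  have : (v.2.factorial : A) = f (C (v.2.factorial : ℂ)) := by simp
  simp only [arcEval, coe_eval₂Hom, eval₂_X, this, genArc, Matrix.map_apply, Matrix.of_apply,
    PowerSeries.coeff_map, PowerSeries.coeff_mk]
  rw [← map_mul, MvPolynomial.smul_eq_C_mul, ← mul_assoc, ← C_mul, mul_inv_cancel₀ h0, C_1, one_mul]

theorem genArc_map_arcEval (κ : ℂ →+* A) (V : Matrix (Fin 3) (Fin 3) (PowerSeries A)) :
    genArc.map (PowerSeries.map (arcEval κ V)) = V := by
  ext i η k
  have h0 : (k.factorial : ℂ) ≠ 0 := by exact_mod_cast k.factorial_ne_zero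
  have : (k.factorial : A) = κ (k.factorial : ℂ) := by simp
  simp only [genArc, Matrix.map_apply, Matrix.of_apply, PowerSeries.coeff_map, PowerSeries.coeff_mk]
  rw [MvPolynomial.smul_eq_C_mul, map_mul]
  simp only [arcEval, coe_eval₂Hom, eval₂_X, eval₂_C, this]
  rw [← mul_assoc, ← map_mul, inv_mul_cancel₀ h0, map_one, one_mul]

theorem derivative_arcEval (κ : ℂ →+* A) (ξ : Fin 3) (s : PowerSeries A)
    (V : Matrix (Fin 3) (Fin 3) (PowerSeries (Polynomial A)))
    (hV : ∀ i η k, Polynomial.derivative (PowerSeries.coeff k (V i η)) =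
      PowerSeries.coeff k (s.map Polynomial.C *
        ∑ θ, PowerSeries.C (Polynomial.C (κ (slBr ξ η θ))) * V i θ)) (p : ArcRing) :
    ∃ N₀, ∀ N ≥ N₀, Polynomial.derivative (arcEval (Polynomial.C.comp κ) V p) =
      ∑ r ∈ Finset.range N, Polynomial.C (PowerSeries.coeff r s) *
        arcEval (Polynomial.C.comp κ) V (arcDer 3 ξ r p) := by
  induction p using MvPolynomial.induction_on with
  | C a =>
    refine ⟨0, fun N _ => ?_⟩
    simp [arcEval, arcDer]
  | add p q hp hq =>
    obtain ⟨N₁, h₁⟩ := hp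
    obtain ⟨N₂, h₂⟩ := hq
    refine ⟨max N₁ N₂, fun N hN => ?_⟩
    simp only [map_add, mul_add, Finset.sum_add_distrib]
    rw [h₁ N (le_trans (le_max_left _ _) hN), h₂ N (le_trans (le_max_right _ _) hN)]
  | mul_X p v hp =>
    obtain ⟨N₁, h₁⟩ := hp
    obtain ⟨⟨i, η⟩, k⟩ := v
    refine ⟨max N₁ (k + 1), fun N hN => ?_⟩
    have hX : Polynomial.derivative (arcEval (Polynomial.C.comp κ) V (X ((i, η), k))) =
        ∑ r ∈ Finset.range N, Polynomial.C (PowerSeries.coeff r s) *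
          arcEval (Polynomial.C.comp κ) V (arcDer 3 ξ r (X ((i, η), k))) := by
      have hk : k + 1 ≤ N := le_trans (le_max_right _ _) hN
      have hf : Polynomial.derivative ((k.factorial : ℕ) : Polynomial A) = 0 := by simp
      rw [show arcEval (Polynomial.C.comp κ) V (X ((i, η), k))
          = (k.factorial : Polynomial A) * PowerSeries.coeff k (V i η) by simp [arcEval],
        Polynomial.derivative_mul, hf, zero_mul, zero_add, hV, PowerSeries.coeff_mul,
        Finset.Nat.sum_antidiagonal_eq_sum_range_succ_mk, Finset.mul_sum,
        ← Finset.sum_subset (Finset.range_mono hk)]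
      · refine Finset.sum_congr rfl fun r hr => ?_
        have hr : r ≤ k := Nat.lt_succ_iff.1 (Finset.mem_range.1 hr)
        have hd : (k.factorial : Polynomial A)
            = (k.descFactorial r : Polynomial A) * ((k - r).factorial : Polynomial A) := by
          rw [← Nat.factorial_mul_descFactorial hr]
          push_cast
          ring
        rw [hd]
        simp only [PowerSeries.coeff_map, arcDer, mkDerivation_X, smul_eq_C_mul, map_mul, map_sum,
          PowerSeries.coeff_C_mul, arcEval, coe_eval₂Hom, eval₂_C, eval₂_X, RingHom.comp_apply,
          map_natCast, Finset.mul_sum]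
        refine Finset.sum_congr rfl fun θ _ => ?_
        ring
      · intro r _ hr
        have hr : k < r := by simpa using hr
        simp [arcDer, mkDerivation_X, Nat.descFactorial_of_lt hr]
    rw [map_mul, Polynomial.derivative_mul, h₁ N (le_trans (le_max_left _ _) hN), hX,
      Finset.sum_mul, Finset.mul_sum, ← Finset.sum_add_distrib]
    refine Finset.sum_congr rfl fun r _ => ?_
    simp only [Derivation.leibniz, smul_eq_mul, map_add, map_mul]
    ring

end Ev

section Gauge

/-- Invariance under all jet derivations. -/
def IsJetInvariant (p : ArcRing) : Prop := ∀ (ξ : Fin 3) (r : ℕ), arcDer 3 ξ r p = 0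

theorem arcEval_eq_of_derivative {K : Type*} [Field K] (κ : ℂ →+* K) (ξ : Fin 3) (s : PowerSeries K)
    (V : Matrix (Fin 3) (Fin 3) (PowerSeries (Polynomial K)))
    (hV : ∀ i η k, Polynomial.derivative (PowerSeries.coeff k (V i η)) =
      PowerSeries.coeff k (s.map Polynomial.C *
        ∑ θ, PowerSeries.C (Polynomial.C (κ (slBr ξ η θ))) * V i θ)) {p : ArcRing}
    (hp : IsJetInvariant p) (a b : K) :
    arcEval κ (V.map (PowerSeries.map (Polynomial.evalRingHom a))) p =
      arcEval κ (V.map (PowerSeries.map (Polynomial.evalRingHom b))) p := by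
  have : CharZero K := (RingHom.charZero_iff κ.injective).1 inferInstance
  obtain ⟨N, hN⟩ := derivative_arcEval κ ξ s V hV p
  have h0 := hN N le_rfl
  simp only [hp ξ, map_zero, mul_zero, Finset.sum_const_zero] at h0
  have h1 := Polynomial.eq_C_of_derivative_eq_zero h0
  have h (a : K) : arcEval κ (V.map (PowerSeries.map (Polynomial.evalRingHom a))) p =
      Polynomial.evalRingHom a (arcEval (Polynomial.C.comp κ) V p) := by
    rw [← RingHom.comp_apply, comp_arcEval]
    congr 2
    ext x
    simp
  rw [h, h, h1]
  simp

variable {K : Type*} [Field K]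

/-- The matrix of the form `q`. -/
def formMat (A : Type*) [CommRing A] : Matrix (Fin 3) (Fin 3) A := !![1, 0, 0; 0, 0, 2; 0, 2, 0]

theorem mul_formMat_mul_transpose {A : Type*} [CommRing A] (V : Matrix (Fin 3) (Fin 3) A)
    (i j : Fin 3) : (V * formMat A * V.transpose) i j = rowForm (V i) (V j) := by
  simp [Matrix.mul_apply, Fin.sum_univ_three, formMat, rowForm]
  ring

/-- Matrices acting on rows that preserve Gram data and the values of all invariants. -/
noncomputable def gaugeMonoid (κ : ℂ →+* K) :
    Submonoid (Matrix (Fin 3) (Fin 3) (PowerSeries K)) where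
  carrier := {M | M * formMat _ * M.transpose = formMat _ ∧ M.det = 1 ∧
    ∀ p, IsJetInvariant p → ∀ V, arcEval κ (V * M) p = arcEval κ V p}
  one_mem' := by simp
  mul_mem' := by
    rintro M N ⟨h1, h2, h3⟩ ⟨h4, h5, h6⟩
    refine ⟨?_, by rw [Matrix.det_mul, h2, h5, one_mul], fun p hp V => ?_⟩
    · rw [Matrix.transpose_mul, show M * N * formMat _ * (N.transpose * M.transpose)
        = M * (N * formMat _ * N.transpose) * M.transpose by simp only [Matrix.mul_assoc], h4, h1]
    · rw [← Matrix.mul_assoc, h6 p hp, h3 p hp]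

theorem gramOf_mul_gaugeMonoid {κ : ℂ →+* K} {M : Matrix (Fin 3) (Fin 3) (PowerSeries K)}
    (hM : M ∈ gaugeMonoid κ) (V : Matrix (Fin 3) (Fin 3) (PowerSeries K)) :
    gramOf (V * M) = gramOf V := by
  obtain ⟨h1, h2, -⟩ := hM
  have h (i j : Fin 3) : rowForm ((V * M) i) ((V * M) j) = rowForm (V i) (V j) := by
    rw [← mul_formMat_mul_transpose, ← mul_formMat_mul_transpose, Matrix.transpose_mul,
      show V * M * formMat _ * (M.transpose * V.transpose)
        = V * (M * formMat _ * M.transpose) * V.transpose by simp only [Matrix.mul_assoc], h1]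
  simp only [gramOf, h, Matrix.det_mul, h2, mul_one]

/-- The row action of the unipotent matrix `exp (s x)`. -/
def unipX {A : Type*} [CommRing A] (s : A) : Matrix (Fin 3) (Fin 3) A :=
  !![1, 0, s; -2 * s, 1, -s ^ 2; 0, 0, 1]

/-- The row action of the unipotent matrix `exp (s y)`. -/
def unipY {A : Type*} [CommRing A] (s : A) : Matrix (Fin 3) (Fin 3) A :=
  !![1, -s, 0; 0, 1, 0; 2 * s, -s ^ 2, 1]

theorem derivative_coeff_quadratic {A : Type*} [CommRing A] (a b c : PowerSeries A) (k : ℕ) :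
    Polynomial.derivative (PowerSeries.coeff k (a.map Polynomial.C
      + PowerSeries.C Polynomial.X * b.map Polynomial.C
      + PowerSeries.C (Polynomial.X ^ 2) * c.map Polynomial.C)) =
    PowerSeries.coeff k (b.map Polynomial.C
      + 2 * PowerSeries.C Polynomial.X * c.map Polynomial.C) := by
  rw [show (2 : PowerSeries (Polynomial A)) = PowerSeries.C 2 from (map_ofNat PowerSeries.C 2).symm,
    ← map_mul]
  simp only [map_add, PowerSeries.coeff_C_mul, PowerSeries.coeff_map, Polynomial.derivative_mul,
    Polynomial.derivative_C, Polynomial.derivative_X, Polynomial.derivative_X_sq]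
  simp [show (Polynomial.C 2 : Polynomial A) = 2 from map_ofNat _ 2]

theorem powerSeries_map_eval_C {A : Type*} [CommRing A] (a : A) (f : PowerSeries A) :
    PowerSeries.map (Polynomial.evalRingHom a) (PowerSeries.map Polynomial.C f) = f := by
  ext
  simp

theorem map_eval_C {A : Type*} [CommRing A] (a : A) (V : Matrix (Fin 3) (Fin 3) (PowerSeries A)) :
    (V.map (PowerSeries.map Polynomial.C)).map (PowerSeries.map (Polynomial.evalRingHom a)) =
      V := by
  ext1 i j
  exact powerSeries_map_eval_C a _

theorem unipX_zero {A : Type*} [CommRing A] : unipX (0 : A) = 1 := by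
  ext i j
  fin_cases i <;> fin_cases j <;> simp [unipX]

theorem unipX_map {A B : Type*} [CommRing A] [CommRing B] (f : A →+* B) (s : A) :
    (unipX s).map f = unipX (f s) := by
  have h2 : f 2 = 2 := map_ofNat f 2
  ext i j
  fin_cases i <;> fin_cases j <;> simp [unipX, h2]

theorem unipY_zero {A : Type*} [CommRing A] : unipY (0 : A) = 1 := by
  ext i j
  fin_cases i <;> fin_cases j <;> simp [unipY]

theorem unipY_map {A B : Type*} [CommRing A] [CommRing B] (f : A →+* B) (s : A) :
    (unipY s).map f = unipY (f s) := by
  have h2 : f 2 = 2 := map_ofNat f 2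
  ext i j
  fin_cases i <;> fin_cases j <;> simp [unipY, h2]

theorem unipX_mem_gaugeMonoid (κ : ℂ →+* K) (s : PowerSeries K) : unipX s ∈ gaugeMonoid κ := by
  refine ⟨?_, ?_, fun p hp V => ?_⟩
  · ext1 i j
    fin_cases i <;> fin_cases j <;>
      simp [unipX, formMat, Matrix.mul_apply, Fin.sum_univ_three] <;> ring
  · simp [unipX, Matrix.det_fin_three]
  · let W : Matrix (Fin 3) (Fin 3) (PowerSeries (Polynomial K)) :=
      V.map (PowerSeries.map Polynomial.C) *
        unipX (PowerSeries.C Polynomial.X * PowerSeries.map Polynomial.C s)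
    have h2 : PowerSeries.map (Polynomial.C (R := K)) 2 = 2 := map_ofNat _ 2
    have hκ : PowerSeries.C (Polynomial.C (κ 2)) = 2 := by
      rw [map_ofNat κ 2, map_ofNat Polynomial.C 2, map_ofNat PowerSeries.C 2]
    have W0 (i) : W i 0 = PowerSeries.map Polynomial.C (V i 0)
        + PowerSeries.C Polynomial.X * PowerSeries.map Polynomial.C (-2 * s * V i 1)
        + PowerSeries.C (Polynomial.X ^ 2) * PowerSeries.map Polynomial.C 0 := by
      simp [W, unipX, Matrix.mul_apply, Fin.sum_univ_three, h2]
      ring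
    have W1 (i) : W i 1 = PowerSeries.map Polynomial.C (V i 1)
        + PowerSeries.C Polynomial.X * PowerSeries.map Polynomial.C 0
        + PowerSeries.C (Polynomial.X ^ 2) * PowerSeries.map Polynomial.C 0 := by
      simp [W, unipX, Matrix.mul_apply, Fin.sum_univ_three]
    have W2 (i) : W i 2 = PowerSeries.map Polynomial.C (V i 2)
        + PowerSeries.C Polynomial.X * PowerSeries.map Polynomial.C (s * V i 0)
        + PowerSeries.C (Polynomial.X ^ 2) * PowerSeries.map Polynomial.C (-s ^ 2 * V i 1) := by
      simp [W, unipX, Matrix.mul_apply, Fin.sum_univ_three]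
      ring
    have key := arcEval_eq_of_derivative κ 1 s W ?_ hp 1 0
    · have hW (a : K) : W.map (PowerSeries.map (Polynomial.evalRingHom a))
          = V * unipX (PowerSeries.C a * s) := by
        rw [Matrix.map_mul, map_eval_C, unipX_map]
        congr 2
        simp [powerSeries_map_eval_C]
      rwa [hW, hW, map_one, one_mul, map_zero, zero_mul, unipX_zero, mul_one] at key
    · intro i η k
      fin_cases η
      · simp only [Fin.zero_eta, W0, derivative_coeff_quadratic]
        congr 1
        simp [slBr, Fin.sum_univ_three, W1, h2, hκ]
        ring
      · simp only [Fin.mk_one, W1, derivative_coeff_quadratic]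
        simp [slBr, Fin.sum_univ_three]
      · simp only [Fin.reduceFinMk, W2, derivative_coeff_quadratic]
        congr 1
        simp [slBr, Fin.sum_univ_three, W0, h2]
        ring

theorem unipY_mem_gaugeMonoid (κ : ℂ →+* K) (s : PowerSeries K) : unipY s ∈ gaugeMonoid κ := by
  refine ⟨?_, ?_, fun p hp V => ?_⟩
  · ext1 i j
    fin_cases i <;> fin_cases j <;>
      simp [unipY, formMat, Matrix.mul_apply, Fin.sum_univ_three] <;> ring
  · simp [unipY, Matrix.det_fin_three]
  · let W : Matrix (Fin 3) (Fin 3) (PowerSeries (Polynomial K)) :=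
      V.map (PowerSeries.map Polynomial.C) *
        unipY (PowerSeries.C Polynomial.X * PowerSeries.map Polynomial.C s)
    have h2 : PowerSeries.map (Polynomial.C (R := K)) 2 = 2 := map_ofNat _ 2
    have hκ : PowerSeries.C (Polynomial.C (κ 2)) = 2 := by
      rw [map_ofNat κ 2, map_ofNat Polynomial.C 2, map_ofNat PowerSeries.C 2]
    have W0 (i) : W i 0 = PowerSeries.map Polynomial.C (V i 0)
        + PowerSeries.C Polynomial.X * PowerSeries.map Polynomial.C (2 * s * V i 2)
        + PowerSeries.C (Polynomial.X ^ 2) * PowerSeries.map Polynomial.C 0 := by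
      simp [W, unipY, Matrix.mul_apply, Fin.sum_univ_three, h2]
      ring
    have W1 (i) : W i 1 = PowerSeries.map Polynomial.C (V i 1)
        + PowerSeries.C Polynomial.X * PowerSeries.map Polynomial.C (-s * V i 0)
        + PowerSeries.C (Polynomial.X ^ 2) * PowerSeries.map Polynomial.C (-s ^ 2 * V i 2) := by
      simp [W, unipY, Matrix.mul_apply, Fin.sum_univ_three]
      ring
    have W2 (i) : W i 2 = PowerSeries.map Polynomial.C (V i 2)
        + PowerSeries.C Polynomial.X * PowerSeries.map Polynomial.C 0
        + PowerSeries.C (Polynomial.X ^ 2) * PowerSeries.map Polynomial.C 0 := by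
      simp [W, unipY, Matrix.mul_apply, Fin.sum_univ_three]
    have key := arcEval_eq_of_derivative κ 2 s W ?_ hp 1 0
    · have hW (a : K) : W.map (PowerSeries.map (Polynomial.evalRingHom a))
          = V * unipY (PowerSeries.C a * s) := by
        rw [Matrix.map_mul, map_eval_C, unipY_map]
        congr 2
        simp [powerSeries_map_eval_C]
      rwa [hW, hW, map_one, one_mul, map_zero, zero_mul, unipY_zero, mul_one] at key
    · intro i η k
      fin_cases η
      · simp only [Fin.zero_eta, W0, derivative_coeff_quadratic]
        congr 1
        simp [slBr, Fin.sum_univ_three, W2, h2, hκ]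
        ring
      · simp only [Fin.mk_one, W1, derivative_coeff_quadratic]
        congr 1
        simp [slBr, Fin.sum_univ_three, W0, h2]
        ring
      · simp only [Fin.reduceFinMk, W2, derivative_coeff_quadratic]
        simp [slBr, Fin.sum_univ_three]

end Gauge

theorem PowerSeries.exists_mul_self_eq {A : Type*} [CommRing A] (κ : ℂ →+* A) {u : PowerSeries A}
    (hu : PowerSeries.coeff 0 u = 1) : ∃ ρ, ρ * ρ = u := by
  let _ : Algebra ℂ A := κ.toAlgebra
  have h : PowerSeries.HasSubst (u - 1) :=
    PowerSeries.HasSubst.of_constantCoeff_zero' (by simpa [sub_eq_zero] using hu)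
  refine ⟨PowerSeries.substAlgHom h (PowerSeries.binomialSeries A (1 / 2 : ℂ)), ?_⟩
  rw [← map_mul, ← PowerSeries.binomialSeries_add, add_halves]
  have := PowerSeries.binomialSeries_nat (R := ℂ) (A := A) 1
  rw [Nat.cast_one, pow_one] at this
  rw [this, map_add, map_one, PowerSeries.substAlgHom_X]
  ring

theorem PowerSeries.exists_mul_self_eq_of_isAlgClosed {K : Type*} [Field K] [IsAlgClosed K]
    (κ : ℂ →+* K) {u : PowerSeries K} (hu : PowerSeries.coeff 0 u ≠ 0) : ∃ ρ, ρ * ρ = u := by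
  obtain ⟨a, ha⟩ := IsAlgClosed.exists_eq_mul_self (PowerSeries.coeff 0 u)
  obtain ⟨ρ, hρ⟩ := PowerSeries.exists_mul_self_eq κ
    (u := PowerSeries.C (PowerSeries.coeff 0 u)⁻¹ * u) (by
      rw [PowerSeries.coeff_C_mul, inv_mul_cancel₀ hu])
  refine ⟨PowerSeries.C a * ρ, ?_⟩
  rw [mul_mul_mul_comm, hρ, ← map_mul, ← ha, ← mul_assoc, ← map_mul, mul_inv_cancel₀ hu, map_one,
    one_mul]

section NormalForm

variable {A B : Type*} [CommRing A] [CommRing B]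

/-- The discriminant of the first two vectors. -/
def Gram.disc (g : Gram A) : A := g.q11 * g.q22 - g.q12 * g.q12

/-- Rows with given Gram data, whose first row is `(r, 0, 0)` and whose second row has middle
entry `1`; the last three arguments are the inverses of `2`, `g.q11` and `g.disc`. -/
def normalForm (g : Gram A) (r half i11 idisc : A) : Matrix (Fin 3) (Fin 3) A :=
  !![r, 0, 0;
    g.q12 * i11 * r, 1, g.disc * i11 * (half * half);
    g.q13 * i11 * r,
    ((g.q23 - g.q12 * g.q13 * i11) * half - g.c * i11 * r) * (2 * g.q11 * idisc),
    ((g.q23 - g.q12 * g.q13 * i11) * half + g.c * i11 * r) * half]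

theorem normalForm_map (f : A →+* B) (g : Gram A) (r half i11 idisc : A) :
    (normalForm g r half i11 idisc).map f =
      normalForm (g.map f) (f r) (f half) (f i11) (f idisc) := by
  have h2 : f 2 = 2 := map_ofNat f 2
  ext i j
  fin_cases i <;> fin_cases j <;> simp [normalForm, Gram.map, Gram.disc, h2]

theorem gramOf_normalForm {g : Gram A} {r half i11 idisc : A} (hr : r * r = g.q11)
    (h2 : 2 * half = 1) (h11 : g.q11 * i11 = 1) (hd : g.disc * idisc = 1) (hrel : g.rel = 0) :
    gramOf (normalForm g r half i11 idisc) = g := by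
  obtain ⟨q11, q22, q33, q23, q13, q12, c⟩ := g
  simp only [Gram.rel, Gram.disc] at *
  simp only [gramOf, rowForm, normalForm, Matrix.det_fin_three, Gram.mk.injEq, Gram.disc]
  simp
  subst hr
  refine ⟨rfl, ?_, ?_, ?_, ?_, ?_, ?_⟩
  · linear_combination (r ^ 2 * q22 - q12 ^ 2) * i11 * (2 * half + 1) * h2
      + (q12 ^ 2 * i11 + q22) * h11
  · linear_combination
      (r ^ 2 * idisc * (q23 - q12 * q13 * i11) ^ 2 * (4 * half ^ 2 + 2 * half + 1)
        - 4 * c ^ 2 * idisc * r ^ 4 * i11 ^ 2) * h2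
      + (-4 * c ^ 2 * idisc * (r ^ 2 * i11 + 1) + q13 ^ 2 * i11 - 2 * idisc * q23 * q12 * q13
        + idisc * q12 ^ 2 * q13 ^ 2 * i11 + idisc * q13 ^ 2 * q22) * h11
      + (q33 - q13 ^ 2 * i11) * hd - idisc * hrel
  · linear_combination
      (((q23 - q12 * q13 * i11) * half + c * i11 * r)
        + ((q23 - q12 * q13 * i11) * half - c * i11 * r) * (2 * half + 1) * r ^ 2 * i11
          * (r ^ 2 * q22 - q12 ^ 2) * idisc + (q23 - q12 * q13 * i11)) * h2
      + (((q23 - q12 * q13 * i11) * half - c * i11 * r) * (r ^ 2 * q22 - q12 ^ 2) * idisc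
        + q12 * q13 * i11) * h11
      + ((q23 - q12 * q13 * i11) * half - c * i11 * r) * hd
  · linear_combination q13 * h11
  · linear_combination q12 * h11
  · linear_combination
      (-r * half * ((q23 - q12 * q13 * i11) * half - c * i11 * r) * r ^ 2 * i11
        * (r ^ 2 * q22 - q12 ^ 2) * idisc + c * r ^ 2 * i11) * h2
      + (-r * half * ((q23 - q12 * q13 * i11) * half - c * i11 * r)
        * (r ^ 2 * q22 - q12 ^ 2) * idisc + c) * h11
      - r * half * ((q23 - q12 * q13 * i11) * half - c * i11 * r) * hd

theorem eq_normalForm {r half i11 idisc a b e x y : A} (h2 : 2 * half = 1)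
    (h11 : r * r * i11 = 1)
    (hd : (gramOf !![r, 0, 0; a, 1, b; e, x, y]).disc * idisc = 1) :
    !![r, 0, 0; a, 1, b; e, x, y]
      = normalForm (gramOf !![r, 0, 0; a, 1, b; e, x, y]) r half i11 idisc := by
  have hd' : 4 * r ^ 2 * b * idisc = 1 := by
    rw [← hd]
    simp [Gram.disc, gramOf, rowForm]
    ring
  ext i j
  fin_cases i <;> fin_cases j <;>
    simp [normalForm, gramOf, rowForm, Matrix.det_fin_three, Gram.disc]
  · linear_combination -a * h11
  · linear_combination -b * r ^ 2 * i11 * (2 * half + 1) * h2 - b * h11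
  · linear_combination -e * h11
  · linear_combination -2 * r ^ 2 * idisc * (y + x * b) * h2
      + 2 * r ^ 2 * idisc * (a * e * half + (y - b * x)) * h11 - x * hd'
  · linear_combination (-half * (y + x * b) - y) * h2
      + half * (a * e * half - (y - b * x)) * h11

end NormalForm

section GaugeFixing

theorem unipX_mul_unipY_mul_unipX {A : Type*} [CommRing A] {l i : A} (h : l * i = 1) :
    unipX l * unipY (-i) * unipX l = !![-1, 0, 0; 0, 0, -l ^ 2; 0, -i ^ 2, 0] := by
  ext a b
  fin_cases a <;> fin_cases b <;>
    simp [unipX, unipY, Matrix.mul_apply, Fin.sum_univ_three]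
  · linear_combination 2 * (l * i - 1) * h
  · linear_combination -i * h
  · linear_combination l * (l * i - 2) * h
  · linear_combination -2 * l * (l * i - 2) * h
  · linear_combination (l * i - 1) * h
  · linear_combination -l ^ 2 * (l * i - 3) * h
  · linear_combination 2 * i * h
  · linear_combination (l * i - 1) * h

theorem torus_mem_gaugeMonoid {K : Type*} [Field K] (κ : ℂ →+* K) {l i : PowerSeries K}
    (h : l * i = 1) : !![1, 0, 0; 0, i ^ 2, 0; 0, 0, l ^ 2] ∈ gaugeMonoid κ := by
  have hw {l i : PowerSeries K} (h : l * i = 1) :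
      !![-1, 0, 0; 0, 0, -l ^ 2; 0, -i ^ 2, 0] ∈ gaugeMonoid κ := by
    rw [← unipX_mul_unipY_mul_unipX h]
    exact mul_mem (mul_mem (unipX_mem_gaugeMonoid κ l) (unipY_mem_gaugeMonoid κ _))
      (unipX_mem_gaugeMonoid κ l)
  convert mul_mem (hw (one_mul 1)) (hw h) using 1
  ext1 a b
  fin_cases a <;> fin_cases b <;> simp [Matrix.mul_apply, Fin.sum_univ_three]

variable {K : Type*} [Field K] {κ : ℂ →+* K}

/-- The gauge-fixing conditions. -/
def IsFixed (r : PowerSeries K) (V : Matrix (Fin 3) (Fin 3) (PowerSeries K)) : Prop :=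
  V 0 0 = r ∧ V 0 1 = 0 ∧ V 0 2 = 0 ∧ V 1 1 = 1

variable {r : PowerSeries K} {V : Matrix (Fin 3) (Fin 3) (PowerSeries K)}

theorem exists_gauge_of_mul {M : Matrix (Fin 3) (Fin 3) (PowerSeries K)} (hM : M ∈ gaugeMonoid κ)
    (h : ∃ N ∈ gaugeMonoid κ, IsFixed r (V * M * N)) : ∃ N ∈ gaugeMonoid κ, IsFixed r (V * N) := by
  obtain ⟨N, hN, h⟩ := h
  exact ⟨M * N, mul_mem hM hN, by rwa [← Matrix.mul_assoc]⟩

variable [IsAlgClosed K]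

theorem exists_gauge_of_first_row
    (hd : PowerSeries.constantCoeff (gramOf V).disc ≠ 0) (h0 : V 0 0 = r) (h1 : V 0 1 = 0)
    (h2 : V 0 2 = 0) : ∃ N ∈ gaugeMonoid κ, IsFixed r (V * N) := by
  have hβ : PowerSeries.constantCoeff (V 1 1) ≠ 0 := by
    intro h
    apply hd
    have : (gramOf V).disc = r * r * (4 * V 1 1 * V 1 2) := by
      simp only [gramOf, Gram.disc, rowForm, h0, h1, h2]
      ring
    rw [this]
    simp [h]
  obtain ⟨l, hl⟩ := PowerSeries.exists_mul_self_eq_of_isAlgClosed κ (u := V 1 1) (by simpa using hβ)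
  have hl0 : PowerSeries.constantCoeff l ≠ 0 := by
    intro h
    rw [← hl, map_mul, h, zero_mul] at hβ
    exact hβ rfl
  have hli := PowerSeries.mul_inv_cancel l hl0
  refine ⟨_, torus_mem_gaugeMonoid κ hli, ?_⟩
  simp only [IsFixed, Matrix.mul_apply, Fin.sum_univ_three]
  simp [h0, h1, h2]
  rw [← hl]
  linear_combination (l * l⁻¹ + 1) * hli

theorem exists_gauge_of_last_eq_zero (hr : PowerSeries.constantCoeff r ≠ 0)
    (hd : PowerSeries.constantCoeff (gramOf V).disc ≠ 0) (h0 : V 0 0 = r)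
    (h2 : V 0 2 = 0) : ∃ N ∈ gaugeMonoid κ, IsFixed r (V * N) := by
  have hM := unipY_mem_gaugeMonoid κ (V 0 1 * r⁻¹)
  have hri := PowerSeries.inv_mul_cancel r hr
  refine exists_gauge_of_mul hM (exists_gauge_of_first_row ?_ ?_ ?_ ?_)
  · rwa [gramOf_mul_gaugeMonoid hM]
  · simp [Matrix.mul_apply, Fin.sum_univ_three, unipY, h0, h2]
  · simp [Matrix.mul_apply, Fin.sum_univ_three, unipY, h0, h2]
    linear_combination -V 0 1 * hri
  · simp [Matrix.mul_apply, Fin.sum_univ_three, unipY, h2]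

theorem exists_gauge_of_middle_ne_zero (hr : PowerSeries.constantCoeff r ≠ 0)
    (hrr : r * r = (gramOf V).q11)
    (hd : PowerSeries.constantCoeff (gramOf V).disc ≠ 0)
    (hx : PowerSeries.constantCoeff (V 0 1) ≠ 0) : ∃ N ∈ gaugeMonoid κ, IsFixed r (V * N) := by
  have : CharZero K := (RingHom.charZero_iff κ.injective).1 inferInstance
  have hx2 : PowerSeries.constantCoeff (2 * V 0 1) ≠ 0 := by
    rw [map_mul, map_ofNat]
    exact mul_ne_zero two_ne_zero hx
  obtain ⟨t, hi⟩ : ∃ t, t * (2 * V 0 1) = 1 := ⟨_, PowerSeries.inv_mul_cancel _ hx2⟩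
  have hM := unipX_mem_gaugeMonoid κ ((V 0 0 - r) * t)
  have h0 : (V * unipX ((V 0 0 - r) * t)) 0 0 = r := by
    simp only [Matrix.mul_apply, Fin.sum_univ_three, unipX]
    simp
    linear_combination -(V 0 0 - r) * hi
  have h1 : (V * unipX ((V 0 0 - r) * t)) 0 1 = V 0 1 := by
    simp [Matrix.mul_apply, Fin.sum_univ_three, unipX]
  refine exists_gauge_of_mul hM (exists_gauge_of_last_eq_zero hr ?_ h0 ?_)
  · rwa [gramOf_mul_gaugeMonoid hM]
  · rw [← gramOf_mul_gaugeMonoid hM V] at hrr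
    simp only [gramOf, rowForm, h0, h1] at hrr
    have h4 : (2 * V 0 1) * (2 * (V * unipX ((V 0 0 - r) * t)) 0 2) = 0 := by
      linear_combination -hrr
    have hV2 : 2 * V 0 1 ≠ 0 := right_ne_zero_of_mul_eq_one hi
    exact ((mul_eq_zero.1 ((mul_eq_zero.1 h4).resolve_left hV2)).resolve_left
      (left_ne_zero_of_mul hV2))

theorem exists_gauge (hrr : r * r = (gramOf V).q11)
    (h11 : PowerSeries.constantCoeff (gramOf V).q11 ≠ 0)
    (hd : PowerSeries.constantCoeff (gramOf V).disc ≠ 0) :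
    ∃ N ∈ gaugeMonoid κ, IsFixed r (V * N) := by
  have : CharZero K := (RingHom.charZero_iff κ.injective).1 inferInstance
  have hr : PowerSeries.constantCoeff r ≠ 0 := by
    intro h
    rw [← hrr, map_mul, h, zero_mul] at h11
    exact h11 rfl
  have key : ∃ s : PowerSeries K, PowerSeries.constantCoeff ((V * unipY s) 0 1) ≠ 0 := by
    by_contra! h
    have e (s : PowerSeries K) := h s
    simp [Matrix.mul_apply, Fin.sum_univ_three, unipY] at e
    have e0 := e 0
    have e1 := e 1
    have e2 := e (-1)
    simp at e0 e1 e2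
    apply h11
    have h2 : PowerSeries.constantCoeff (2 : PowerSeries K) = 2 := map_ofNat _ 2
    simp only [gramOf, rowForm, map_add, map_mul, e0]
    have : PowerSeries.constantCoeff (V 0 0) = 0 := by
      have : 2 * PowerSeries.constantCoeff (V 0 0) = 0 := by linear_combination e2 - e1
      simpa using this
    simp [this]
  obtain ⟨s, hs⟩ := key
  have hM := unipY_mem_gaugeMonoid κ s
  refine exists_gauge_of_mul hM (exists_gauge_of_middle_ne_zero hr ?_ ?_ hs) <;>
    rwa [gramOf_mul_gaugeMonoid hM]

end GaugeFixing

theorem arcEval_eq_normalForm {K : Type*} [Field K] [IsAlgClosed K] {κ : ℂ →+* K}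
    {V : Matrix (Fin 3) (Fin 3) (PowerSeries K)} {r half i11 idisc : PowerSeries K}
    (hrr : r * r = (gramOf V).q11) (h2 : 2 * half = 1) (h11 : (gramOf V).q11 * i11 = 1)
    (hd : (gramOf V).disc * idisc = 1) {p : ArcRing} (hp : IsJetInvariant p)
    (L : Matrix (Fin 3) (Fin 3) (PowerSeries K)) :
    arcEval κ (L * V) p = arcEval κ (L * normalForm (gramOf V) r half i11 idisc) p := by
  have hne {a b : PowerSeries K} (h : a * b = 1) : PowerSeries.constantCoeff a ≠ 0 := by
    intro h0
    have := congrArg PowerSeries.constantCoeff h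
    rw [map_mul, h0, zero_mul, map_one] at this
    exact zero_ne_one this
  obtain ⟨M, hM, h00, h01, h02, hM11⟩ := exists_gauge (κ := κ) hrr (hne h11) (hne hd)
  rw [← gramOf_mul_gaugeMonoid hM, ← hM.2.2 p hp, Matrix.mul_assoc]
  rw [← gramOf_mul_gaugeMonoid hM] at hd h11 hrr
  congr 2
  have hVM : V * M = !![r, 0, 0; (V * M) 1 0, 1, (V * M) 1 2;
      (V * M) 2 0, (V * M) 2 1, (V * M) 2 2] := by
    ext1 i j
    fin_cases i <;> fin_cases j <;> simp [h00, h01, h02, hM11]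
  rw [hVM] at hd ⊢
  rw [← hrr] at h11
  exact congrArg (L * ·) (eq_normalForm h2 h11 hd)

section Root

variable {A : Type*} [CommRing A]

theorem exists_root_data (κ : ℂ →+* A) {g : Gram (PowerSeries A)}
    (h11 : IsUnit (PowerSeries.coeff 0 g.q11)) (hd : IsUnit (PowerSeries.coeff 0 g.disc)) :
    ∃ ρ i11 idisc : PowerSeries A, PowerSeries.C (PowerSeries.coeff 0 g.q11) * (ρ * ρ) = g.q11 ∧
      g.q11 * i11 = 1 ∧ g.disc * idisc = 1 := by
  obtain ⟨u, hu⟩ := h11.exists_right_inv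
  obtain ⟨ρ, hρ⟩ := PowerSeries.exists_mul_self_eq κ (u := PowerSeries.C u * g.q11) (by
    rw [PowerSeries.coeff_C_mul, mul_comm, hu])
  obtain ⟨i11, h1⟩ := (PowerSeries.isUnit_iff_constantCoeff.2 (by simpa using h11)).exists_right_inv
  obtain ⟨idisc, h2⟩ :=
    (PowerSeries.isUnit_iff_constantCoeff.2 (by simpa using hd)).exists_right_inv
  refine ⟨ρ, i11, idisc, ?_, h1, h2⟩
  rw [hρ, ← mul_assoc, ← map_mul, hu, map_one, one_mul]

theorem QuadraticAlgebra.exists_ringHom {K : Type*} [CommRing K] (ι : A →+* K) {a : A} {s : K}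
    (h : s * s = ι a) :
    ∃ f : QuadraticAlgebra A a 0 →+* K, ∀ z, f z = ι z.re + s * ι z.im := by
  let _ : Algebra A K := ι.toAlgebra
  refine ⟨(QuadraticAlgebra.lift ⟨s, ?_⟩ : QuadraticAlgebra A a 0 →ₐ[A] K), fun z => ?_⟩
  · simp [Algebra.smul_def, h, RingHom.algebraMap_toAlgebra]
  · simp [Algebra.smul_def, RingHom.algebraMap_toAlgebra, mul_comm]

/-- The normal form of Gram data over the quadratic extension by a square root of `q11(0)`. -/
noncomputable def rootNormalForm (κ : ℂ →+* A) (g : Gram (PowerSeries A))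
    (ρ i11 idisc : PowerSeries A) : Matrix (Fin 3) (Fin 3)
      (PowerSeries (QuadraticAlgebra A (PowerSeries.coeff 0 g.q11) 0)) :=
  normalForm (g.map (PowerSeries.map (algebraMap A _)))
    (PowerSeries.C QuadraticAlgebra.omega * PowerSeries.map (algebraMap A _) ρ)
    (PowerSeries.C (algebraMap A _ (κ (1 / 2)))) (PowerSeries.map (algebraMap A _) i11)
    (PowerSeries.map (algebraMap A _) idisc)

theorem two_mul_C_half (κ : ℂ →+* A) : 2 * PowerSeries.C (κ (1 / 2)) = 1 := by
  rw [← map_ofNat PowerSeries.C 2, ← map_ofNat κ 2, ← map_mul, ← map_mul]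
  norm_num

theorem exists_gramOf_eq (κ : ℂ →+* A) {g : Gram (PowerSeries A)}
    (h11 : IsUnit (PowerSeries.coeff 0 g.q11)) (hd : IsUnit (PowerSeries.coeff 0 g.disc))
    (hrel : g.rel = 0) :
    ∃ (a : A) (N : Matrix (Fin 3) (Fin 3) (PowerSeries (QuadraticAlgebra A a 0))),
      gramOf N = g.map (PowerSeries.map (algebraMap A _)) := by
  obtain ⟨ρ, i11, idisc, h1, h2, h3⟩ := exists_root_data κ h11 hd
  refine ⟨_, rootNormalForm κ g ρ i11 idisc, gramOf_normalForm ?_ ?_ ?_ ?_ ?_⟩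
  · rw [mul_mul_mul_comm, ← map_mul, ← map_mul, QuadraticAlgebra.omega_mul_omega_eq_algebraMap]
    refine Eq.trans ?_ (congrArg (PowerSeries.map (algebraMap A _)) h1)
    simp only [map_zero, zero_mul, add_zero, map_mul, PowerSeries.map_C]
  · exact two_mul_C_half ((algebraMap A _).comp κ)
  · simp only [Gram.map]
    rw [← map_mul, h2, map_one]
  · simp only [Gram.map, Gram.disc] at h3 ⊢
    rw [← map_mul, ← map_mul, ← map_sub, ← map_mul, h3, map_one]
  · rw [Gram.rel_map, hrel, map_zero]

theorem exists_arcEval_eq_of_invariant {K : Type*} [Field K] [IsAlgClosed K] (κ : ℂ →+* A)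
    (ι : A →+* K) {g : Gram (PowerSeries A)} (h11 : IsUnit (PowerSeries.coeff 0 g.q11))
    (hd : IsUnit (PowerSeries.coeff 0 g.disc)) {V : Matrix (Fin 3) (Fin 3) (PowerSeries K)}
    (hV : gramOf V = g.map (PowerSeries.map ι)) {p : ArcRing} (hp : IsJetInvariant p)
    (L : Matrix (Fin 3) (Fin 3) ℤ) :
    ∃ a, arcEval (ι.comp κ) (intMat _ L * V) p = ι a := by
  have : CharZero K := (RingHom.charZero_iff (ι.comp κ).injective).1 inferInstance
  obtain ⟨ρ, i11, idisc, h1, h2, h3⟩ := exists_root_data κ h11 hd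
  obtain ⟨s, hs⟩ := IsAlgClosed.exists_eq_mul_self (ι (PowerSeries.coeff 0 g.q11))
  have hs0 : s ≠ 0 := by
    rintro rfl
    have := h11.map ι
    rw [hs] at this
    simp at this
  have key {s : K} (hs : s * s = ι (PowerSeries.coeff 0 g.q11)) :
      arcEval (ι.comp κ) (intMat _ L * V) p =
        ι (arcEval ((algebraMap A _).comp κ) (intMat _ L * rootNormalForm κ g ρ i11 idisc) p).re +
        s * ι (arcEval ((algebraMap A _).comp κ)
          (intMat _ L * rootNormalForm κ g ρ i11 idisc) p).im := by
    obtain ⟨f, hf⟩ := QuadraticAlgebra.exists_ringHom ι hs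
    have hfe : f.comp (algebraMap A _) = ι := by
      ext a
      simp [hf]
    have hfe' (x : PowerSeries A) : PowerSeries.map f (PowerSeries.map (algebraMap A _) x) =
        PowerSeries.map ι x := by
      rw [← hfe]
      ext
      simp
    have hq : (gramOf V).q11 = PowerSeries.map ι g.q11 := by rw [hV]; rfl
    have hdisc : (gramOf V).disc = PowerSeries.map ι g.disc := by
      rw [hV]
      simp [Gram.disc, Gram.map]
    rw [← hf, ← RingHom.comp_apply f, comp_arcEval, ← RingHom.comp_assoc, hfe, Matrix.map_mul,
      intMat_map, rootNormalForm, normalForm_map, map_mul, hfe', hfe', hfe', PowerSeries.map_C,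
      PowerSeries.map_C, Gram.map_map,
      show (PowerSeries.map f ∘ PowerSeries.map (algebraMap A _)) = PowerSeries.map ι from
        funext hfe', ← hV]
    refine arcEval_eq_normalForm ?_ ?_ ?_ ?_ hp _
    · have h1' := congrArg (PowerSeries.map ι) h1
      rw [map_mul, map_mul, PowerSeries.map_C, ← hs] at h1'
      rw [hq]
      refine Eq.trans ?_ h1'
      simp [hf]
      ring
    · exact two_mul_C_half (f.comp ((algebraMap A _).comp κ))
    · rw [hq, ← map_mul, h2, map_one]
    · rw [hdisc, ← map_mul, h3, map_one]
  have e1 := key hs.symm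
  have e2 := key (s := -s) (by rw [neg_mul_neg, hs])
  refine ⟨_, e1.trans (add_eq_left.2 ?_)⟩
  have : 2 * (s * ι (arcEval ((algebraMap A _).comp κ)
      (intMat _ L * rootNormalForm κ g ρ i11 idisc) p).im) = 0 := by
    linear_combination e2 - e1
  simpa using this

end Root

section Descent

theorem arcEval_comp_C {A : Type*} [CommRing A] (κ : ℂ →+* A)
    (V : Matrix (Fin 3) (Fin 3) (PowerSeries A)) : (arcEval κ V).comp C = κ := by
  ext x
  simp [arcEval]

theorem intMat_mul_cancel {A : Type*} [CommRing A] {L L' : Matrix (Fin 3) (Fin 3) ℤ}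
    (h : L * L' = 1) (V : Matrix (Fin 3) (Fin 3) A) : intMat A L * (intMat A L' * V) = V := by
  rw [← Matrix.mul_assoc, ← intMat_mul, h, intMat_one, one_mul]

/-- The specialization of the generic Gram data to that of an integral combination of the
generic arcs. -/
noncomputable def arcClassifyMul (L : Matrix (Fin 3) (Fin 3) ℤ) :
    MvPolynomial GramVar ℂ →+* ArcRing :=
  classify C (gramOf (intMat _ L * genArc))

theorem arcEval_comp_arcClassifyMul {A : Type*} [CommRing A] (κ : ℂ →+* A)
    {L L' : Matrix (Fin 3) (Fin 3) ℤ} (h : L * L' = 1)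
    (V : Matrix (Fin 3) (Fin 3) (PowerSeries A)) :
    (arcEval κ (intMat _ L' * V)).comp (arcClassifyMul L) = classify κ (gramOf V) := by
  rw [arcClassifyMul, comp_classify, arcEval_comp_C, ← gramOf_map, Matrix.map_mul, intMat_map,
    genArc_map_arcEval, intMat_mul_cancel h]

theorem coeff_zero_disc_swap {A : Type*} [CommRing A] (g : Gram (PowerSeries A)) :
    PowerSeries.coeff 0 g.swap.disc = g.minor13 := by
  simp [Gram.disc, Gram.swap, Gram.minor13, sq]

theorem coeff_zero_disc_shear {A : Type*} [CommRing A] (g : Gram (PowerSeries A)) :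
    PowerSeries.coeff 0 g.shear.disc = g.minorSum := by
  have h2 : PowerSeries.constantCoeff (2 : PowerSeries A) = 2 := map_ofNat _ 2
  simp [Gram.disc, Gram.shear, Gram.minorSum, sq, h2]

theorem coeff_zero_genGram_q11 : PowerSeries.coeff 0 genGram.q11 = X (.inr (0, 0)) := by
  simp [genGram]

theorem exists_pow_mul_mem_relIdeal {L L' : Matrix (Fin 3) (Fin 3) ℤ} (hL : L * L' = 1)
    {s : MvPolynomial GramVar ℂ} (hs : arcClassifyMul L s = 0) :
    ∃ n : ℕ, (X (.inr (0, 0)) * genGram.minor13) ^ n * s ∈ relIdeal := by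
  let δ : MvPolynomial GramVar ℂ := X (.inr (0, 0)) * genGram.minor13
  let A := Localization.Away (Ideal.Quotient.mk relIdeal δ)
  let π : MvPolynomial GramVar ℂ →+* A :=
    (algebraMap (MvPolynomial GramVar ℂ ⧸ relIdeal) A).comp (Ideal.Quotient.mk relIdeal)
  have hu : IsUnit (π (X (.inr (0, 0)))) ∧ IsUnit (π genGram.minor13) := by
    rw [← IsUnit.mul_iff, ← map_mul]
    exact IsLocalization.Away.algebraMap_isUnit (S := A) (Ideal.Quotient.mk relIdeal δ)
  have hrel : (genGram.map (PowerSeries.map π)).rel = 0 := by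
    rw [Gram.rel_map]
    ext k
    have : Ideal.Quotient.mk relIdeal (PowerSeries.coeff k genGram.rel) = 0 :=
      Ideal.Quotient.eq_zero_iff_mem.2 (Ideal.subset_span ⟨k, rfl⟩)
    simp [π, this]
  obtain ⟨d, N, hN⟩ := exists_gramOf_eq (π.comp C) (g := (genGram.map (PowerSeries.map π)).swap)
    (by
      have : PowerSeries.coeff 0 (genGram.map (PowerSeries.map π)).swap.q11
          = π (X (.inr (0, 0))) := by
        rw [← coeff_zero_genGram_q11]
        rfl
      rw [this]
      exact hu.1)
    (by
      rw [coeff_zero_disc_swap, Gram.minor13_map]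
      exact hu.2)
    (by rw [Gram.rel_swap, hrel])
  let e := algebraMap A (QuadraticAlgebra A d 0)
  have key := arcEval_comp_arcClassifyMul ((e.comp π).comp C) hL (intMat _ swapMat * N)
  rw [gramOf_swapMat_mul, hN, Gram.swap_map, Gram.swap_swap, Gram.map_map,
    show PowerSeries.map e ∘ PowerSeries.map π = PowerSeries.map (e.comp π) by
      rw [PowerSeries.map_comp]; rfl,
    ← ringHom_eq_classify] at key
  have h0 : e (π s) = 0 := by
    rw [← RingHom.comp_apply, ← key, RingHom.comp_apply, hs, map_zero]
  have h1 : π s = 0 := QuadraticAlgebra.algebraMap_injective (h0.trans (map_zero e).symm)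
  obtain ⟨⟨_, n, rfl⟩, hn⟩ :=
    (IsLocalization.map_eq_zero_iff (Submonoid.powers (Ideal.Quotient.mk relIdeal δ)) A _).1 h1
  exact ⟨n, Ideal.Quotient.eq_zero_iff_mem.1 (by simpa [δ] using hn)⟩

theorem exists_pow_mul_eq_map {φ : MvPolynomial GramVar ℂ →+* ArcRing} (hφ : φ.comp C = C)
    {M M' : Matrix (Fin 3) (Fin 3) ℤ} (hM : M' * M = 1)
    {h : Gram (PowerSeries (MvPolynomial GramVar ℂ))}
    (hh : gramOf (intMat _ M * genArc) = h.map (PowerSeries.map φ))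
    {δ : MvPolynomial GramVar ℂ}
    (hδ : PowerSeries.coeff 0 h.q11 * PowerSeries.coeff 0 h.disc = δ) (hδ0 : φ δ ≠ 0)
    {p : ArcRing} (hp : IsJetInvariant p) : ∃ n s, φ δ ^ n * p = φ s := by
  let A := Localization.Away δ
  let K := AlgebraicClosure (FractionRing ArcRing)
  let j : ArcRing →+* K := (algebraMap (FractionRing ArcRing) K).comp (algebraMap ArcRing _)
  have hj : Function.Injective j :=
    (algebraMap (FractionRing ArcRing) K).injective.comp (IsFractionRing.injective ArcRing _)
  have hu : IsUnit (j.comp φ δ) := by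
    refine IsUnit.mk0 _ fun h0 => hδ0 (hj ?_)
    rw [map_zero, ← h0]
    rfl
  let α : MvPolynomial GramVar ℂ →+* A := algebraMap _ A
  let ι : A →+* K := IsLocalization.Away.lift δ hu
  have hι : ι.comp α = j.comp φ := IsLocalization.Away.lift_comp δ hu
  have hαu : IsUnit (α (PowerSeries.coeff 0 h.q11)) ∧ IsUnit (α (PowerSeries.coeff 0 h.disc)) := by
    rw [← IsUnit.mul_iff, ← map_mul, hδ]
    exact IsLocalization.Away.algebraMap_isUnit (S := A) δ
  have hV : gramOf (intMat _ M * genArc.map (PowerSeries.map j))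
      = (h.map (PowerSeries.map α)).map (PowerSeries.map ι) := by
    rw [← intMat_map (PowerSeries.map j), ← Matrix.map_mul, gramOf_map, hh, Gram.map_map,
      Gram.map_map]
    congr 1
    ext f n
    simpa using (RingHom.congr_fun hι (PowerSeries.coeff n f)).symm
  obtain ⟨a, ha⟩ := exists_arcEval_eq_of_invariant (α.comp C) ι
    (by simpa [Gram.map] using hαu.1)
    (by
      have : (h.map (PowerSeries.map α)).disc = PowerSeries.map α h.disc := by
        simp [Gram.disc, Gram.map]
      simpa [this] using hαu.2) hV hp M'
  rw [intMat_mul_cancel hM, ← RingHom.comp_assoc, hι, RingHom.comp_assoc, hφ, arcEval_genArc] at ha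
  obtain ⟨n, s, hs⟩ := IsLocalization.Away.surj δ a
  refine ⟨n, s, hj ?_⟩
  have h1 := congrArg ι hs
  have h2 (x) : ι (algebraMap _ A x) = j (φ x) := RingHom.congr_fun hι x
  rw [map_mul, map_pow, h2, h2, ← ha] at h1
  rw [map_mul, map_pow, mul_comm, h1]

end Descent

section Generation

theorem gramOf_rel {A : Type*} [CommRing A] (V : Matrix (Fin 3) (Fin 3) A) :
    (gramOf V).rel = 0 := by
  simp only [Gram.rel, gramOf, rowForm, Matrix.det_fin_three]
  ring

theorem relIdeal_le_ker_classify {A : Type*} [CommRing A] (κ : ℂ →+* A)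
    (V : Matrix (Fin 3) (Fin 3) (PowerSeries A)) :
    relIdeal ≤ RingHom.ker (classify κ (gramOf V)) := by
  refine Ideal.span_le.2 ?_
  rintro _ ⟨k, rfl⟩
  have := Gram.rel_map (PowerSeries.map (classify κ (gramOf V))) genGram
  rw [genGram_map_classify, gramOf_rel] at this
  have := congrArg (PowerSeries.coeff k) this
  simpa [eq_comm] using this

theorem classify_q11 {A : Type*} [CommRing A] (κ : ℂ →+* A) (g : Gram (PowerSeries A)) :
    classify κ g (X (.inr (0, 0))) = PowerSeries.coeff 0 g.q11 := by
  simp [classify]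

variable {L L' : Matrix (Fin 3) (Fin 3) ℤ}

theorem arcClassifyMul_minors_ne_zero (hL : L * L' = 1) :
    arcClassifyMul L (X (.inr (0, 0)) * genGram.minor13) ≠ 0 ∧
      arcClassifyMul L (X (.inr (0, 0)) * genGram.minorSum) ≠ 0 := by
  let W : Matrix (Fin 3) (Fin 3) (PowerSeries ℂ) := !![1, 0, 0; 0, 0, 0; 0, 1, 1]
  have key (a) := RingHom.congr_fun (arcEval_comp_arcClassifyMul (RingHom.id ℂ) hL W) a
  have h2 : PowerSeries.constantCoeff (2 : PowerSeries ℂ) = 2 := map_ofNat _ 2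
  constructor <;> intro h
  · have := key (X (.inr (0, 0)) * genGram.minor13)
    rw [RingHom.comp_apply, h, map_zero, map_mul, classify_q11, ← Gram.minor13_map,
      genGram_map_classify] at this
    simp [Gram.minor13, gramOf, rowForm, W, h2] at this
    norm_num at this
  · have := key (X (.inr (0, 0)) * genGram.minorSum)
    rw [RingHom.comp_apply, h, map_zero, map_mul, classify_q11, ← Gram.minorSum_map,
      genGram_map_classify] at this
    simp [Gram.minorSum, gramOf, rowForm, W, h2] at this
    norm_num at this

theorem arcClassifyMul_eq_zero_iff (hL : L * L' = 1) {s : MvPolynomial GramVar ℂ} :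
    arcClassifyMul L s = 0 ↔ s ∈ relIdeal := by
  refine ⟨fun h => ?_, fun h => relIdeal_le_ker_classify _ _ h⟩
  obtain ⟨n, hn⟩ := exists_pow_mul_mem_relIdeal hL h
  obtain ⟨N, hN⟩ := exists_q11_pow_mul_mem hn
  exact mem_of_pow_mul_mem (fun _ => mem_relIdeal_of_q11_mul_mem) N hN

theorem exists_q11_pow_mul_eq (hL : L * L' = 1) {p : ArcRing} (hp : IsJetInvariant p) :
    ∃ (N : ℕ) (a : MvPolynomial GramVar ℂ),
      arcClassifyMul L (X (.inr (0, 0))) ^ N * p = arcClassifyMul L a := by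
  have hL' : L' * L = 1 := mul_eq_one_comm.1 hL
  have hC : (arcClassifyMul L).comp C = C := classify_comp_C _ _
  have hgen : genGram.map (PowerSeries.map (arcClassifyMul L)) = gramOf (intMat _ L * genArc) :=
    genGram_map_classify _ _
  have hinv {U U' : Matrix (Fin 3) (Fin 3) ℤ} (h : U' * U = 1) : L' * U' * (U * L) = 1 := by
    rw [Matrix.mul_assoc, ← Matrix.mul_assoc U', h, one_mul, hL']
  obtain ⟨h13, hsum⟩ := arcClassifyMul_minors_ne_zero hL
  obtain ⟨n, b, hb⟩ := exists_pow_mul_eq_map (M := swapMat * L) (h := genGram.swap) hC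
    (hinv (U' := swapMat) (by decide))
    (by rw [intMat_mul, Matrix.mul_assoc, gramOf_swapMat_mul, ← Gram.swap_map, hgen])
    (by rw [coeff_zero_disc_swap, ← coeff_zero_genGram_q11]; rfl) h13 hp
  obtain ⟨m, a, ha⟩ := exists_pow_mul_eq_map (M := shearMat * L) (h := genGram.shear) hC
    (hinv (U' := !![1, 0, 0; 0, 1, -1; 0, 0, 1]) (by decide))
    (by rw [intMat_mul, Matrix.mul_assoc, gramOf_shearMat_mul, ← Gram.shear_map, hgen])
    (by rw [coeff_zero_disc_shear, ← coeff_zero_genGram_q11]; rfl) hsum hp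
  obtain ⟨N, c, hc⟩ := exists_q11_pow_mul_sub_mem (a := b) (b := a) (m := m) (n := n) <|
    (arcClassifyMul_eq_zero_iff hL).1 <| by
      rw [map_sub, map_mul, map_mul, map_pow, map_pow, ← hb, ← ha]
      ring
  refine ⟨N + n, c, ?_⟩
  have h := (arcClassifyMul_eq_zero_iff hL).2 hc
  rw [map_sub, map_mul, map_mul, map_pow, map_pow, ← hb, map_mul] at h
  rw [map_mul] at h13
  refine mul_left_cancel₀ (pow_ne_zero n (right_ne_zero_of_mul h13)) ?_
  linear_combination h

theorem arcClassifyMul_one : arcClassifyMul 1 = arcClassify := by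
  rw [arcClassifyMul, intMat_one, one_mul, arcClassify]

theorem arcClassifyMul_shearFirstMat :
    arcClassifyMul shearFirstMat = arcClassify.comp (classify C genGram.shearFirst) := by
  rw [comp_classify, ← Gram.shearFirst_map, arcClassify, genGram_map_classify, classify_comp_C,
    ← gramOf_shearFirstMat_mul, arcClassifyMul]

theorem mem_jetInvariants {p : ArcRing} (hp : IsJetInvariant p) : p ∈ jetInvariants := by
  have hker {s} : arcClassify s = 0 ↔ s ∈ relIdeal := by
    rw [← arcClassifyMul_one]
    exact arcClassifyMul_eq_zero_iff (one_mul 1)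
  obtain ⟨N, a, ha⟩ := exists_q11_pow_mul_eq (one_mul 1) hp
  obtain ⟨M, b, hb⟩ := exists_q11_pow_mul_eq (L := shearFirstMat)
    (L' := !![1, -1, 0; 0, 1, 0; 0, 0, 1]) (by decide) hp
  rw [arcClassifyMul_one] at ha
  rw [arcClassifyMul_shearFirstMat, RingHom.comp_apply, RingHom.comp_apply, classify_q11,
    show PowerSeries.coeff 0 genGram.shearFirst.q11
      = X (.inr (0, 0)) + 2 * X (.inr (2, 0)) + X (.inl (0, 0)) by
        have h2 : PowerSeries.constantCoeff (2 : PowerSeries (MvPolynomial GramVar ℂ)) = 2 :=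
          map_ofNat _ 2
        simp [Gram.shearFirst, genGram, h2]] at hb
  have hmem : a ∈ Ideal.span {X (.inr (0, 0)) ^ N} ⊔ relIdeal := by
    refine mem_sup_of_pow_mul_mem_sup (fun _ => mem_relIdeal_of_q11_mul_mem)
      (fun _ => mem_of_q11_add_mul_mem) M N (Ideal.mem_span_singleton_sup.2
        ⟨classify C genGram.shearFirst b, _, hker.1 ?_, add_sub_cancel _ _⟩)
    rw [map_sub, map_mul, map_mul, map_pow, map_pow, ← ha, ← hb]
    ring
  obtain ⟨c, i, hi, rfl⟩ := Ideal.mem_span_singleton_sup.1 hmem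
  have h0 : arcClassify (X (.inr (0, 0))) ≠ 0 := by
    have := (arcClassifyMul_minors_ne_zero (one_mul 1)).1
    rw [arcClassifyMul_one, map_mul] at this
    exact left_ne_zero_of_mul this
  rw [map_add, hker.2 hi, add_zero, map_mul, map_pow, mul_comm] at ha
  rw [mul_right_cancel₀ (pow_ne_zero N h0) ha]
  exact arcClassify_mem c

end Generation

/-- Theorem 6.3, second part: for `g = sl₂` acting diagonally on `W = V ⊕ V ⊕ V`
(`V` the adjoint representation), `O(J_∞(W))^{g[t]}` is generated as a `ℂ`-algebra
by the elements `D^k(q_{ij})` and `D^k(c_{123})`, `k ≥ 0`; i.e. it is generated as a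
differential algebra by `O(W)^{SL₂}`. -/
theorem stmt_10 :
    ∀ p : MvPolynomial ((Fin 3 × Fin 3) × ℕ) ℂ,
      (∀ (ξ : Fin 3) (r : ℕ), arcDer 3 ξ r p = 0) ↔
        p ∈ Algebra.adjoin ℂ
          ({w | ∃ (k : ℕ) (i j : Fin 3), w = (⇑(arcD 3))^[k] (arcQ 3 i j)} ∪
           {w | ∃ k : ℕ, w = (⇑(arcD 3))^[k] arcC}) := by
  exact fun p => ⟨fun hp => mem_jetInvariants hp, fun hp => arcDer_eq_zero_of_mem_jetInvariants hp⟩
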